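/- arXiv:2205.02755 — 4 statements merged into one kernel-verified Lean document; each statement's English description precedes it below -/
import Mathlib

section
/- Let p₀, p ∈ S² and a ∈ (0,π), and suppose p ∉ B(p₀,a), i.e. arccos⟨p₀,p⟩ ≥ a. Then (1/(4π sin²(a/2))) · ∫_{q ∈ B(p₀,a)} ln‖p − q‖ dσ(q) = ln‖p − p₀‖ − 1/2 − cot²(a/2)·ln cos(a/2). -/
open MeasureTheory Real Filter
open scoped RealInnerProductSpace

noncomputable abbrev E3 := EuclideanSpace ℝ (Fin 3)

noncomputable abbrev S2 := Metric.sphere (0 : E3) 1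

/-- The surface measure on the unit sphere `S²` (total mass `4π`). -/
noncomputable def σ2 : Measure S2 := (volume : Measure E3).toSphere

open scoped ENNReal Pointwise

/-- Tonelli's theorem combined with polar coordinates in the plane. -/
theorem lintegral_prod_eq_lintegral_polar (f : ℝ × ℝ → ℝ≥0∞) (hf : Measurable f) :
    ∫⁻ w, f w = ∫⁻ ψ in Set.Ioo (-π) π, ∫⁻ r in Set.Ioi (0 : ℝ),
      ENNReal.ofReal r * f (r * cos ψ, r * sin ψ) := by
  rw [← lintegral_comp_polarCoord_symm, polarCoord_target, Measure.volume_eq_prod,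
    setLIntegral_prod_symm]
  · simp
  · refine Measurable.aemeasurable ?_
    simp only [polarCoord_symm_apply, smul_eq_mul]
    fun_prop

/-- Spherical coordinates in `ℝ × ℝ × ℝ`. -/
theorem lintegral_eq_lintegral_spherical (G : ℝ × ℝ × ℝ → ℝ≥0∞) (hG : Measurable G) :
    ∫⁻ x, G x = ∫⁻ ψ in Set.Ioo (-π) π, ∫⁻ θ in Set.Ioo 0 π, ∫⁻ r in Set.Ioi (0 : ℝ),
      ENNReal.ofReal (r ^ 2 * sin θ) *
        G (r * cos θ, r * sin θ * cos ψ, r * sin θ * sin ψ) := by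
  have half_plane (ψ : ℝ) : ∫⁻ z, ∫⁻ ρ in Set.Ioi (0 : ℝ),
      ENNReal.ofReal ρ * G (z, ρ * cos ψ, ρ * sin ψ) =
      ∫⁻ θ in Set.Ioo 0 π, ∫⁻ r in Set.Ioi (0 : ℝ), ENNReal.ofReal (r ^ 2 * sin θ) *
        G (r * cos θ, r * sin θ * cos ψ, r * sin θ * sin ψ) := by
    set H : ℝ × ℝ → ℝ≥0∞ := {w | 0 < w.2}.indicator
      fun w ↦ ENNReal.ofReal w.2 * G (w.1, w.2 * cos ψ, w.2 * sin ψ) with hH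
    have hHm : Measurable H :=
      Measurable.indicator (by fun_prop) (measurableSet_lt measurable_const measurable_snd)
    calc _ = ∫⁻ w, H w := by
          rw [Measure.volume_eq_prod, lintegral_prod _ hHm.aemeasurable]
          refine lintegral_congr fun z ↦ ?_
          rw [← lintegral_indicator measurableSet_Ioi]
          rfl
      _ = _ := by
          rw [lintegral_prod_eq_lintegral_polar H hHm,
            ← lintegral_indicator measurableSet_Ioo, ← lintegral_indicator measurableSet_Ioo]
          refine lintegral_congr fun θ ↦ ?_
          by_cases h0 : θ ∈ Set.Ioo 0 π
          · have h1 : θ ∈ Set.Ioo (-π) π := ⟨by linarith [h0.1, pi_pos], h0.2⟩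
            rw [Set.indicator_of_mem h0, Set.indicator_of_mem h1]
            refine setLIntegral_congr_fun measurableSet_Ioi fun r hr ↦ ?_
            have hs := sin_pos_of_pos_of_lt_pi h0.1 h0.2
            have hr : 0 < r := hr
            have hpos : 0 < r * sin θ := mul_pos hr hs
            simp only [hH]
            rw [Set.indicator_of_mem (by exact hpos), ← mul_assoc, ← ENNReal.ofReal_mul hr.le]
            congr 2
            ring
          · rw [Set.indicator_of_notMem h0]
            by_cases h1 : θ ∈ Set.Ioo (-π) π
            · rw [Set.indicator_of_mem h1, setLIntegral_eq_zero measurableSet_Ioi]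
              intro r hr
              have hθ : θ ≤ 0 := by
                by_contra! h
                exact h0 ⟨h, h1.2⟩
              have hs := sin_nonpos_of_nonpos_of_neg_pi_le hθ h1.1.le
              have : ¬ 0 < r * sin θ := not_lt.2 (mul_nonpos_of_nonneg_of_nonpos (le_of_lt hr) hs)
              simp [hH, this]
            · rw [Set.indicator_of_notMem h1]
  calc ∫⁻ x, G x = ∫⁻ z, ∫⁻ w : ℝ × ℝ, G (z, w) := by
        rw [Measure.volume_eq_prod, lintegral_prod _ hG.aemeasurable]
    _ = ∫⁻ z, ∫⁻ ψ in Set.Ioo (-π) π, ∫⁻ ρ in Set.Ioi (0 : ℝ),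
        ENNReal.ofReal ρ * G (z, ρ * cos ψ, ρ * sin ψ) := by
        refine lintegral_congr fun z ↦ ?_
        exact lintegral_prod_eq_lintegral_polar _ (by fun_prop)
    _ = ∫⁻ ψ in Set.Ioo (-π) π, ∫⁻ z, ∫⁻ ρ in Set.Ioi (0 : ℝ),
        ENNReal.ofReal ρ * G (z, ρ * cos ψ, ρ * sin ψ) := by
        refine lintegral_lintegral_swap (Measurable.aemeasurable ?_)
        refine Measurable.lintegral_prod_right' (f := fun w : (ℝ × ℝ) × ℝ ↦
          ENNReal.ofReal w.2 * G (w.1.1, w.2 * cos w.1.2, w.2 * sin w.1.2)) ?_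
        fun_prop
    _ = _ := lintegral_congr half_plane

/-- Integration over `E3` in coordinates with respect to an orthonormal basis. -/
theorem lintegral_eq_lintegral_orthonormalBasis (b : OrthonormalBasis (Fin 3) ℝ E3)
    (F : E3 → ℝ≥0∞) :
    ∫⁻ x, F x = ∫⁻ w : ℝ × ℝ × ℝ, F (w.1 • b 0 + w.2.1 • b 1 + w.2.2 • b 2) := by
  have h1 := b.measurePreserving_repr_symm
  have h2 := PiLp.volume_preserving_toLp (Fin 3)
  have h3 := (volume_preserving_piFinSuccAbove (fun _ : Fin 3 ↦ ℝ) 0).symm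
  have h4 := (MeasurePreserving.id (volume : Measure ℝ)).prod
    (volume_preserving_finTwoArrow ℝ).symm
  rw [← h1.lintegral_comp_emb b.repr.symm.toHomeomorph.measurableEmbedding,
    ← h2.lintegral_comp_emb (MeasurableEquiv.toLp 2 (Fin 3 → ℝ)).measurableEmbedding,
    ← h3.lintegral_comp_emb (MeasurableEquiv.measurableEmbedding _),
    Measure.volume_eq_prod ℝ (ℝ × ℝ)]
  erw [← h4.lintegral_comp_emb
    ((MeasurableEquiv.refl ℝ).prodCongr MeasurableEquiv.finTwoArrow.symm).measurableEmbedding]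
  refine lintegral_congr fun w ↦ ?_
  congr 1
  rw [← b.sum_repr_symm]
  simp [Fin.sum_univ_three]

/-- The point of the unit sphere with polar angle `w.1` (measured from `b 0`) and azimuth `w.2`. -/
noncomputable def sphericalPoint (b : OrthonormalBasis (Fin 3) ℝ E3) (w : ℝ × ℝ) : S2 :=
  ⟨cos w.1 • b 0 + (sin w.1 * cos w.2) • b 1 + (sin w.1 * sin w.2) • b 2, by
    have h : cos w.1 • b 0 + (sin w.1 * cos w.2) • b 1 + (sin w.1 * sin w.2) • b 2 =
        b.repr.symm !₂[cos w.1, sin w.1 * cos w.2, sin w.1 * sin w.2] := by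
      rw [← b.sum_repr_symm]
      simp [Fin.sum_univ_three]
    rw [mem_sphere_zero_iff_norm, h, LinearIsometryEquiv.norm_map, EuclideanSpace.norm_eq]
    simp only [Fin.sum_univ_three, norm_eq_abs, sq_abs]
    rw [sqrt_eq_one]
    simp
    nlinarith [sin_sq_add_cos_sq w.1, sin_sq_add_cos_sq w.2]⟩

theorem measurable_sphericalPoint (b : OrthonormalBasis (Fin 3) ℝ E3) :
    Measurable (sphericalPoint b) := by
  unfold sphericalPoint
  exact Measurable.subtype_mk (by fun_prop)

/-- The open cone of height one over a measurable subset of the sphere is measurable. -/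
theorem measurableSet_Ioo_smul_sphere {s : Set S2} (hs : MeasurableSet s) :
    MeasurableSet (Set.Ioo (0 : ℝ) 1 • ((↑) '' s : Set E3)) := by
  have emb : MeasurableEmbedding (Subtype.val ∘ (homeomorphUnitSphereProd E3).symm) :=
    (MeasurableEmbedding.subtype_coe (measurableSet_singleton _).compl).comp
      (Homeomorph.measurableEmbedding _)
  have h : Set.Ioo (0 : ℝ) 1 • ((↑) '' s : Set E3) =
      (Subtype.val ∘ (homeomorphUnitSphereProd E3).symm) ''
        (s ×ˢ Set.Iio (⟨1, Set.mem_Ioi.2 one_pos⟩ : Set.Ioi (0 : ℝ))) := by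
    ext x
    constructor
    · rintro ⟨r, hr, _, ⟨u, hu, rfl⟩, rfl⟩
      exact ⟨(u, ⟨r, hr.1⟩), ⟨hu, hr.2⟩, by simp⟩
    · rintro ⟨⟨u, r⟩, ⟨hu, hr⟩, rfl⟩
      exact ⟨r, ⟨r.2, hr⟩, u, ⟨u, hu, rfl⟩, by simp⟩
  rw [h]
  exact emb.measurableSet_image.2 (hs.prod measurableSet_Iio)

theorem smul_mem_Ioo_smul_sphere_iff {s : Set S2} {u : S2} {r : ℝ} (hr : 0 < r) :
    r • (u : E3) ∈ Set.Ioo (0 : ℝ) 1 • ((↑) '' s : Set E3) ↔ r < 1 ∧ u ∈ s := by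
  constructor
  · rintro ⟨t, ht, _, ⟨v, hv, rfl⟩, h⟩
    have h : t • (v : E3) = r • (u : E3) := h
    have hn := congrArg norm h
    rw [norm_smul, norm_smul, mem_sphere_zero_iff_norm.1 u.2, mem_sphere_zero_iff_norm.1 v.2,
      norm_of_nonneg hr.le, norm_of_nonneg ht.1.le, mul_one, mul_one] at hn
    subst hn
    have huv : v = u := Subtype.ext (smul_right_injective E3 hr.ne' h)
    exact ⟨ht.2, huv ▸ hv⟩
  · rintro ⟨h, hu⟩
    exact ⟨r, ⟨hr, h⟩, u, ⟨u, hu, rfl⟩, rfl⟩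

theorem lintegral_Ioo_sq : ∫⁻ r in Set.Ioo (0 : ℝ) 1, ENNReal.ofReal (r ^ 2) =
    ENNReal.ofReal (1 / 3) := by
  rw [← ofReal_integral_eq_lintegral_ofReal, ← integral_Ioc_eq_integral_Ioo,
    ← intervalIntegral.integral_of_le zero_le_one, integral_pow]
  · norm_num
  · exact (continuous_pow 2).integrableOn_Icc.mono_set Set.Ioo_subset_Icc_self
  · exact ae_of_all _ fun r ↦ sq_nonneg r

/-- The measure `sin θ dθ` on the interval `(0, π)` of polar angles. -/
noncomputable def polarAngleMeasure : Measure ℝ :=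
  (volume.restrict (Set.Ioo 0 π)).withDensity fun θ ↦ ENNReal.ofReal (sin θ)

instance : SFinite polarAngleMeasure := by
  unfold polarAngleMeasure
  infer_instance

/-- The surface measure of the sphere in spherical coordinates is `sin θ dθ dψ`. -/
theorem map_sphericalPoint (b : OrthonormalBasis (Fin 3) ℝ E3) :
    (polarAngleMeasure.prod (volume.restrict (Set.Ioo (-π) π))).map (sphericalPoint b) = σ2 := by
  ext s hs
  have hind : Measurable fun w : ℝ × ℝ ↦ (sphericalPoint b ⁻¹' s).indicator (1 : ℝ × ℝ → ℝ≥0∞) w :=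
    measurable_one.indicator (measurable_sphericalPoint b hs)
  have hC := measurableSet_Ioo_smul_sphere hs
  have hradial (θ ψ : ℝ) (hθ : θ ∈ Set.Ioo 0 π) :
      ∫⁻ r in Set.Ioi (0 : ℝ), ENNReal.ofReal (r ^ 2 * sin θ) *
        (Set.Ioo (0 : ℝ) 1 • ((↑) '' s : Set E3)).indicator 1 ((r * cos θ) • b 0 +
          (r * sin θ * cos ψ) • b 1 + (r * sin θ * sin ψ) • b 2) =
      ENNReal.ofReal (1 / 3) * (ENNReal.ofReal (sin θ) *
        (sphericalPoint b ⁻¹' s).indicator (1 : ℝ × ℝ → ℝ≥0∞) (θ, ψ)) := by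
    have hsq := lintegral_Ioo_sq
    rw [← Set.Ioi_inter_Iio, Set.inter_comm] at hsq
    rw [← hsq, ← lintegral_mul_const _ (by fun_prop), ← setLIntegral_indicator measurableSet_Iio]
    refine setLIntegral_congr_fun measurableSet_Ioi fun r hr ↦ ?_
    have hr : 0 < r := hr
    have hpt : (r * cos θ) • b 0 + (r * sin θ * cos ψ) • b 1 + (r * sin θ * sin ψ) • b 2 =
        r • (sphericalPoint b (θ, ψ) : E3) := by
      simp only [sphericalPoint, smul_add, smul_smul, mul_assoc]
    simp only [hpt]
    have hmem := smul_mem_Ioo_smul_sphere_iff (s := s) (u := sphericalPoint b (θ, ψ)) hr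
    rw [ENNReal.ofReal_mul (sq_nonneg r)]
    by_cases h1 : r < 1 <;> by_cases h2 : sphericalPoint b (θ, ψ) ∈ s <;>
      simp [Set.indicator, hmem, h1, h2]
  rw [Measure.map_apply (measurable_sphericalPoint b) hs,
    ← lintegral_indicator_one (measurable_sphericalPoint b hs),
    lintegral_prod_symm _ hind.aemeasurable, σ2, Measure.toSphere_apply' _ hs,
    ← lintegral_indicator_one hC, lintegral_eq_lintegral_orthonormalBasis b,
    lintegral_eq_lintegral_spherical
      (fun w ↦ (Set.Ioo (0 : ℝ) 1 • ((↑) '' s : Set E3)).indicator 1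
        (w.1 • b 0 + w.2.1 • b 1 + w.2.2 • b 2))
      ((measurable_one.indicator hC).comp (by fun_prop))]
  have key : ∀ ψ, ∫⁻ θ in Set.Ioo 0 π, ∫⁻ r in Set.Ioi (0 : ℝ), ENNReal.ofReal (r ^ 2 * sin θ) *
        (Set.Ioo (0 : ℝ) 1 • ((↑) '' s : Set E3)).indicator 1 ((r * cos θ) • b 0 +
          (r * sin θ * cos ψ) • b 1 + (r * sin θ * sin ψ) • b 2) =
      ENNReal.ofReal (1 / 3) * ∫⁻ θ, (sphericalPoint b ⁻¹' s).indicator 1 (θ, ψ)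
        ∂polarAngleMeasure := by
    intro ψ
    have hψ : Measurable fun θ ↦ (sphericalPoint b ⁻¹' s).indicator (1 : ℝ × ℝ → ℝ≥0∞) (θ, ψ) :=
      hind.comp (by fun_prop)
    rw [setLIntegral_congr_fun measurableSet_Ioo fun θ hθ ↦ hradial θ ψ hθ,
      lintegral_const_mul _ (by fun_prop), polarAngleMeasure,
      lintegral_withDensity_eq_lintegral_mul _ (by fun_prop) hψ]
    rfl
  rw [lintegral_congr key, lintegral_const_mul, ← mul_assoc]
  · rw [finrank_euclideanSpace_fin, ← ENNReal.ofReal_natCast, ← ENNReal.ofReal_mul (by simp)]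
    norm_num
  · exact hind.lintegral_prod_left'

/-- The mean value property of `log ‖u - v z‖` on the unit circle. -/
theorem integral_log_norm_sub_mul_exp {u v : ℂ} (h : ‖v‖ < ‖u‖) :
    ∫ ψ in Set.Ioo (-π) π, log ‖u - v * Complex.exp (ψ * Complex.I)‖ = 2 * π * log ‖u‖ := by
  have hne : ∀ z ∈ Metric.closedBall (0 : ℂ) |1|, u - v * z ≠ 0 := by
    intro z hz h0
    rw [abs_one, mem_closedBall_zero_iff] at hz
    rw [sub_eq_zero.1 h0, norm_mul] at h
    nlinarith [norm_nonneg v]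
  have havg := AnalyticOnNhd.circleAverage_log_norm_of_ne_zero (c := 0) (R := 1)
    (g := fun z ↦ u - v * z) (fun z _ ↦ by fun_prop) hne
  rw [circleAverage_def] at havg
  have hper : Function.Periodic
      (fun ψ : ℝ ↦ log ‖u - v * Complex.exp (ψ * Complex.I)‖) (2 * π) := by
    intro ψ
    simp [add_mul, Complex.exp_add, Complex.exp_two_pi_mul_I]
  have hshift := hper.intervalIntegral_add_eq (-π) 0
  rw [show -π + 2 * π = π by ring, zero_add] at hshift
  rw [← integral_Ioc_eq_integral_Ioo,
    ← intervalIntegral.integral_of_le (by linarith [pi_pos]), hshift]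
  simp only [circleMap, Complex.ofReal_one, one_mul, zero_add, mul_zero, sub_zero,
    smul_eq_mul] at havg
  rw [← havg, mul_inv_cancel_left₀ (by positivity)]

section Latitude

variable {c x y t s : ℝ}

/-- The squared chordal distance from the point `(c, x, y)` of the sphere to a point at height `t`,
written as the squared distance of complex numbers. -/
theorem sq_norm_sub_mul_exp (hp : c ^ 2 + x ^ 2 + y ^ 2 = 1) (hq : t ^ 2 + s ^ 2 = 1) (ψ : ℝ) :
    ‖(((1 - c) * (1 + t) : ℝ) : ℂ) - (s * (x - y * Complex.I)) * Complex.exp (ψ * Complex.I)‖ ^ 2 =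
      ((1 - c) * (1 + t)) * (2 - 2 * (c * t + s * (x * cos ψ + y * sin ψ))) := by
  rw [← Complex.normSq_eq_norm_sq, Complex.normSq_apply, Complex.exp_mul_I,
    ← Complex.ofReal_cos, ← Complex.ofReal_sin]
  simp [Complex.cos_ofReal_re, Complex.sin_ofReal_re]
  linear_combination (s ^ 2 * (x ^ 2 + y ^ 2)) * sin_sq_add_cos_sq ψ + s ^ 2 * hp + (1 - c ^ 2) * hq

theorem norm_mul_sub_mul_I_lt (hp : c ^ 2 + x ^ 2 + y ^ 2 = 1) (hq : t ^ 2 + s ^ 2 = 1)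
    (ht : -1 < t) (hct : c < t) (hc : c < 1) :
    ‖(s * (x - y * Complex.I) : ℂ)‖ < ‖(((1 - c) * (1 + t) : ℝ) : ℂ)‖ := by
  refine lt_of_pow_lt_pow_left₀ 2 (norm_nonneg _) ?_
  rw [Complex.norm_real, norm_eq_abs, sq_abs, ← Complex.normSq_eq_norm_sq, Complex.normSq_apply]
  simp
  have h1 : 0 < (1 - c) * (1 + t) * (2 * (t - c)) :=
    mul_pos (mul_pos (by linarith) (by linarith)) (by linarith)
  have h2 : s * x * (s * x) + s * y * (s * y) = (1 - t ^ 2) * (1 - c ^ 2) := by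
    linear_combination s ^ 2 * hp + (1 - c ^ 2) * hq
  rw [h2]
  linear_combination h1

theorem chord_sq_pos (hp : c ^ 2 + x ^ 2 + y ^ 2 = 1) (hq : t ^ 2 + s ^ 2 = 1)
    (ht : -1 < t) (hct : c < t) (hc : c < 1) (ψ : ℝ) :
    0 < 2 - 2 * (c * t + s * (x * cos ψ + y * sin ψ)) := by
  have hA : 0 < (1 - c) * (1 + t) := mul_pos (by linarith) (by linarith)
  refine pos_of_mul_pos_right ?_ hA.le
  rw [← sq_norm_sub_mul_exp hp hq ψ]
  refine pow_pos (norm_pos_iff.2 fun h ↦ ?_) 2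
  have hlt := norm_mul_sub_mul_I_lt hp hq ht hct hc
  rw [sub_eq_zero.1 h, norm_mul _ (Complex.exp _), Complex.norm_exp_ofReal_mul_I, mul_one] at hlt
  exact lt_irrefl _ hlt

/-- The average of the logarithmic chordal distance over a circle of latitude. -/
theorem integral_log_chord (hp : c ^ 2 + x ^ 2 + y ^ 2 = 1) (hq : t ^ 2 + s ^ 2 = 1)
    (ht : -1 < t) (hct : c < t) (hc : c < 1) :
    ∫ ψ in Set.Ioo (-π) π, log (2 - 2 * (c * t + s * (x * cos ψ + y * sin ψ))) / 2 =
      π * log ((1 - c) * (1 + t)) := by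
  have hA : 0 < (1 - c) * (1 + t) := mul_pos (by linarith) (by linarith)
  have hlt := norm_mul_sub_mul_I_lt hp hq ht hct hc
  have hlog (ψ : ℝ) : log ‖(((1 - c) * (1 + t) : ℝ) : ℂ) -
      (s * (x - y * Complex.I)) * Complex.exp (ψ * Complex.I)‖ =
      log (2 - 2 * (c * t + s * (x * cos ψ + y * sin ψ))) / 2 + log ((1 - c) * (1 + t)) / 2 := by
    have h := congrArg log (sq_norm_sub_mul_exp hp hq ψ)
    rw [log_pow, log_mul hA.ne' (chord_sq_pos hp hq ht hct hc ψ).ne'] at h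
    push_cast at h ⊢
    linarith
  have hint := integral_log_norm_sub_mul_exp hlt
  simp only [hlog] at hint
  have hcont : Continuous fun ψ : ℝ ↦
      log (2 - 2 * (c * t + s * (x * cos ψ + y * sin ψ))) / 2 :=
    (Continuous.log (by fun_prop) fun ψ ↦ (chord_sq_pos hp hq ht hct hc ψ).ne').div_const 2
  rw [integral_add (hcont.integrableOn_Icc.mono_set Set.Ioo_subset_Icc_self)
    (integrable_const _), Complex.norm_real, norm_of_nonneg hA.le] at hint
  simp at hint
  rw [max_eq_left (by positivity)] at hint
  linarith

end Latitude

theorem inner_sphericalPoint (b : OrthonormalBasis (Fin 3) ℝ E3) (p : E3) (w : ℝ × ℝ) :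
    ⟪p, (sphericalPoint b w : E3)⟫ = ⟪p, b 0⟫ * cos w.1 +
      sin w.1 * (⟪p, b 1⟫ * cos w.2 + ⟪p, b 2⟫ * sin w.2) := by
  simp only [sphericalPoint, inner_add_right, real_inner_smul_right]
  ring

theorem norm_sub_sq_of_sphere (p q : S2) :
    ‖(p : E3) - (q : E3)‖ ^ 2 = 2 - 2 * ⟪(p : E3), (q : E3)⟫ := by
  rw [norm_sub_sq_real, mem_sphere_zero_iff_norm.1 p.2, mem_sphere_zero_iff_norm.1 q.2]
  ring

theorem log_norm_sub_of_sphere (p q : S2) :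
    log ‖(p : E3) - (q : E3)‖ = log (2 - 2 * ⟪(p : E3), (q : E3)⟫) / 2 := by
  rw [← norm_sub_sq_of_sphere, log_pow]
  push_cast
  ring

theorem log_norm_sub_le_log_two (p q : S2) : log ‖(p : E3) - (q : E3)‖ ≤ log 2 := by
  have h : ‖(p : E3) - (q : E3)‖ ≤ 2 := by
    have := norm_sub_le (p : E3) (q : E3)
    rw [mem_sphere_zero_iff_norm.1 p.2, mem_sphere_zero_iff_norm.1 q.2] at this
    linarith
  rcases (norm_nonneg ((p : E3) - (q : E3))).eq_or_lt with h0 | h0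
  · rw [← h0, log_zero]
    exact log_nonneg one_le_two
  · exact log_le_log h0 h

/-- There is an orthonormal basis starting with a given unit vector. -/
theorem exists_orthonormalBasis_zero_eq (p₀ : S2) :
    ∃ b : OrthonormalBasis (Fin 3) ℝ E3, b 0 = p₀ := by
  have hv : Orthonormal ℝ (({0} : Set (Fin 3)).domRestrict fun _ ↦ (p₀ : E3)) := by
    rw [orthonormal_subsingleton_iff]
    exact fun _ ↦ mem_sphere_zero_iff_norm.1 p₀.2
  obtain ⟨b, hb⟩ := hv.exists_orthonormalBasis_extension_of_card_eq (by simp)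
  exact ⟨b, hb 0 rfl⟩

theorem restrict_polarAngleMeasure_Iio {a : ℝ} (ha : a ≤ π) :
    polarAngleMeasure.restrict (Set.Iio a) =
      (volume.restrict (Set.Ioo 0 a)).withDensity fun θ ↦ ENNReal.ofReal (sin θ) := by
  rw [polarAngleMeasure, restrict_withDensity measurableSet_Iio,
    Measure.restrict_restrict measurableSet_Iio]
  congr 2
  ext θ
  simp only [Set.mem_inter_iff, Set.mem_Iio, Set.mem_Ioo]
  constructor
  · exact fun h ↦ ⟨h.2.1, h.1⟩
  · exact fun h ↦ ⟨h.2, h.1, h.2.trans_le ha⟩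

/-- Restricting `sin θ dθ dψ` to a geodesic ball around the pole. -/
theorem restrict_preimage_geodesicBall (b : OrthonormalBasis (Fin 3) ℝ E3) {a : ℝ} (ha : a ≤ π) :
    (polarAngleMeasure.prod (volume.restrict (Set.Ioo (-π) π))).restrict
        (sphericalPoint b ⁻¹' {q : S2 | arccos ⟪b 0, (q : E3)⟫ < a}) =
      ((volume.restrict (Set.Ioo 0 a)).withDensity fun θ ↦ ENNReal.ofReal (sin θ)).prod
        (volume.restrict (Set.Ioo (-π) π)) := by
  have hae : ∀ᵐ w ∂(polarAngleMeasure.prod (volume.restrict (Set.Ioo (-π) π))),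
      w.1 ∈ Set.Ioo 0 π := by
    refine Measure.quasiMeasurePreserving_fst.ae (p := fun θ ↦ θ ∈ Set.Ioo 0 π) ?_
    exact (withDensity_absolutelyContinuous _ _).ae_le (ae_restrict_mem measurableSet_Ioo)
  have hset : (sphericalPoint b ⁻¹' {q : S2 | arccos ⟪b 0, (q : E3)⟫ < a}) =ᵐ[
      polarAngleMeasure.prod (volume.restrict (Set.Ioo (-π) π))] Set.Iio a ×ˢ Set.univ := by
    filter_upwards [hae] with w hw
    apply propext
    have h : ⟪b 0, (sphericalPoint b w : E3)⟫ = cos w.1 := by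
      rw [inner_sphericalPoint, b.inner_eq_one, b.inner_eq_zero (by decide),
        b.inner_eq_zero (by decide)]
      ring
    change arccos ⟪b 0, (sphericalPoint b w : E3)⟫ < a ↔ w ∈ Set.Iio a ×ˢ Set.univ
    rw [h, arccos_cos hw.1.le hw.2.le]
    simp
  rw [Measure.restrict_congr_set hset, ← Measure.prod_restrict, Measure.restrict_univ,
    restrict_polarAngleMeasure_Iio ha]

/-- The integral over polar angles of the circular means of the logarithmic distance. -/
theorem integral_sin_mul_log {a c : ℝ} (ha : a ∈ Set.Ioo 0 π) (hc : c < 1) :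
    ∫ θ in 0..a, sin θ * log ((1 - c) * (1 + cos θ)) =
      4 * sin (a / 2) ^ 2 * (log (2 * (1 - c)) / 2 - 1 / 2 -
        cot (a / 2) ^ 2 * log (cos (a / 2))) := by
  have hcos : ∀ θ ∈ Set.uIcc 0 a, 0 < (1 - c) * (1 + cos θ) := by
    intro θ hθ
    rw [Set.uIcc_of_le ha.1.le] at hθ
    have : cos π < cos θ := cos_lt_cos_of_nonneg_of_le_pi hθ.1 le_rfl (hθ.2.trans_lt ha.2)
    rw [cos_pi] at this
    exact mul_pos (by linarith) (by linarith)
  have hderiv : ∀ θ ∈ Set.uIcc 0 a, HasDerivAt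
      (fun θ ↦ -((1 - c) * (1 + cos θ) * log ((1 - c) * (1 + cos θ)) -
        (1 - c) * (1 + cos θ)) / (1 - c)) (sin θ * log ((1 - c) * (1 + cos θ))) θ := by
    intro θ hθ
    have h1 : HasDerivAt (fun θ ↦ (1 - c) * (1 + cos θ)) ((1 - c) * (-sin θ)) θ :=
      ((hasDerivAt_cos θ).const_add 1).const_mul (1 - c)
    have h2 := (((h1.mul (h1.log (hcos θ hθ).ne')).sub h1).neg).div_const (1 - c)
    convert! h2 using 1
    have h3 := (hcos θ hθ).ne'
    have h4 : 1 - c ≠ 0 := by linarith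
    have h5 : 1 + cos θ ≠ 0 := right_ne_zero_of_mul h3
    field_simp
    ring
  have hcont : ContinuousOn (fun θ ↦ sin θ * log ((1 - c) * (1 + cos θ))) (Set.uIcc 0 a) :=
    continuous_sin.continuousOn.mul
      (ContinuousOn.log (by fun_prop) fun θ hθ ↦ (hcos θ hθ).ne')
  rw [intervalIntegral.integral_eq_sub_of_hasDerivAt hderiv hcont.intervalIntegrable]
  have hC : 0 < cos (a / 2) := cos_pos_of_mem_Ioo ⟨by linarith [ha.1, pi_pos], by linarith [ha.2]⟩
  have hS : 0 < sin (a / 2) := sin_pos_of_pos_of_lt_pi (by linarith [ha.1]) (by linarith [ha.1, ha.2])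
  have hca : 1 + cos a = 2 * cos (a / 2) ^ 2 := by
    rw [cos_sq, mul_div_cancel₀ a two_ne_zero]
    ring
  have hc' : 1 - c ≠ 0 := by linarith
  have hlog : log ((1 - c) * (1 + cos a)) = log (2 * (1 - c)) + 2 * log (cos (a / 2)) := by
    rw [hca, show (1 - c) * (2 * cos (a / 2) ^ 2) = 2 * (1 - c) * cos (a / 2) ^ 2 by ring,
      log_mul (by simpa using hc') (by positivity), log_pow]
    norm_num
  rw [hlog, hca, cos_zero, cot_eq_cos_div_sin, show (1 - c) * (1 + 1) = 2 * (1 - c) by ring]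
  field_simp
  rw [sin_sq]
  ring

/-- Integration of the logarithmic distance in spherical coordinates over a geodesic ball. -/
theorem setIntegral_log_norm_sub (b : OrthonormalBasis (Fin 3) ℝ E3) (p : S2) {a : ℝ}
    (ha : a ∈ Set.Ioo 0 π) (hp : a ≤ arccos ⟪b 0, (p : E3)⟫) :
    ∫ q in {q : S2 | arccos ⟪b 0, (q : E3)⟫ < a}, log ‖(p : E3) - (q : E3)‖ ∂σ2 =
      π * ∫ θ in 0..a, sin θ * log ((1 - ⟪b 0, (p : E3)⟫) * (1 + cos θ)) := by
  set c := ⟪b 0, (p : E3)⟫ with hcdef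
  have hcap : MeasurableSet {q : S2 | arccos ⟪b 0, (q : E3)⟫ < a} :=
    (isOpen_lt (by fun_prop) continuous_const).measurableSet
  have hf : Measurable fun q : S2 ↦ log ‖(p : E3) - (q : E3)‖ := by fun_prop
  have hfs : Measurable fun w : ℝ × ℝ ↦ log ‖(p : E3) - (sphericalPoint b w : E3)‖ :=
    hf.comp (measurable_sphericalPoint b)
  have hc : c < 1 := by
    by_contra! h
    rw [arccos_eq_zero.2 h] at hp
    exact hp.not_gt ha.1
  have hcos (θ : ℝ) (hθ : θ ∈ Set.Ioo 0 a) : -1 < cos θ ∧ c < cos θ := by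
    constructor
    · rw [← cos_pi]
      exact cos_lt_cos_of_nonneg_of_le_pi hθ.1.le le_rfl (hθ.2.trans ha.2)
    · by_contra! h
      have := antitone_arccos h
      rw [arccos_cos hθ.1.le (hθ.2.trans ha.2).le] at this
      exact (hp.trans this).not_gt hθ.2
  have hunit : c ^ 2 + ⟪(p : E3), b 1⟫ ^ 2 + ⟪(p : E3), b 2⟫ ^ 2 = 1 := by
    have h := b.sum_sq_norm_inner_left (p : E3)
    rw [Fin.sum_univ_three, mem_sphere_zero_iff_norm.1 p.2] at h
    simpa [hcdef, real_inner_comm] using h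
  have hlog (θ ψ : ℝ) : log ‖(p : E3) - (sphericalPoint b (θ, ψ) : E3)‖ =
      log (2 - 2 * (c * cos θ +
        sin θ * (⟪(p : E3), b 1⟫ * cos ψ + ⟪(p : E3), b 2⟫ * sin ψ))) / 2 := by
    rw [log_norm_sub_of_sphere, inner_sphericalPoint, hcdef, real_inner_comm]
  have hmean (θ : ℝ) (hθ : θ ∈ Set.Ioo 0 a) :
      ∫ ψ in Set.Ioo (-π) π, log ‖(p : E3) - (sphericalPoint b (θ, ψ) : E3)‖ =
        π * log ((1 - c) * (1 + cos θ)) := by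
    simp only [hlog]
    exact integral_log_chord hunit (cos_sq_add_sin_sq θ) (hcos θ hθ).1 (hcos θ hθ).2 hc
  have hint_circle (θ : ℝ) (hθ : θ ∈ Set.Ioo 0 a) : IntegrableOn
      (fun ψ ↦ log ‖(p : E3) - (sphericalPoint b (θ, ψ) : E3)‖) (Set.Ioo (-π) π) := by
    simp only [hlog]
    have hpos := chord_sq_pos hunit (cos_sq_add_sin_sq θ) (hcos θ hθ).1 (hcos θ hθ).2 hc
    have hcont : Continuous fun ψ ↦ log (2 - 2 * (c * cos θ +
        sin θ * (⟪(p : E3), b 1⟫ * cos ψ + ⟪(p : E3), b 2⟫ * sin ψ))) / 2 :=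
      (Continuous.log (by fun_prop) fun ψ ↦ (hpos ψ).ne').div_const 2
    exact hcont.integrableOn_Icc.mono_set Set.Ioo_subset_Icc_self
  set μ := (volume.restrict (Set.Ioo 0 a)).withDensity fun θ ↦ ENNReal.ofReal (sin θ) with hμ
  have hμle : μ ≤ volume.restrict (Set.Ioo 0 a) := by
    calc μ ≤ (volume.restrict (Set.Ioo 0 a)).withDensity 1 :=
          withDensity_mono (ae_of_all _ fun θ ↦ by simpa using sin_le_one θ)
      _ = _ := withDensity_one
  have : IsFiniteMeasure μ := isFiniteMeasure_of_le _ hμle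
  have hmem : ∀ᵐ θ ∂μ, θ ∈ Set.Ioo 0 a :=
    (withDensity_absolutelyContinuous _ _).ae_le (ae_restrict_mem measurableSet_Ioo)
  have hmean_int : Integrable (fun θ ↦ π * log ((1 - c) * (1 + cos θ))) μ := by
    have hcont : ContinuousOn (fun θ ↦ π * log ((1 - c) * (1 + cos θ))) (Set.Icc 0 a) := by
      refine continuousOn_const.mul (ContinuousOn.log (by fun_prop) fun θ hθ ↦ ?_)
      have : cos π < cos θ := cos_lt_cos_of_nonneg_of_le_pi hθ.1 le_rfl (hθ.2.trans_lt ha.2)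
      rw [cos_pi] at this
      exact (mul_pos (by linarith) (by linarith)).ne'
    exact Integrable.mono_measure
      (hcont.integrableOn_Icc.mono_set Set.Ioo_subset_Icc_self) hμle
  have hint : Integrable (fun w : ℝ × ℝ ↦ log ‖(p : E3) - (sphericalPoint b w : E3)‖)
      (μ.prod (volume.restrict (Set.Ioo (-π) π))) := by
    suffices h : Integrable
        (fun w : ℝ × ℝ ↦ log 2 - log ‖(p : E3) - (sphericalPoint b w : E3)‖)
        (μ.prod (volume.restrict (Set.Ioo (-π) π))) by
      exact ((integrable_const (log 2)).sub h).congr (ae_of_all _ fun w ↦ sub_sub_cancel _ _)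
    rw [integrable_prod_iff (hfs.const_sub _).aestronglyMeasurable]
    constructor
    · filter_upwards [hmem] with θ hθ
      exact (integrable_const _).sub (hint_circle θ hθ)
    · refine ((integrable_const (2 * π * log 2)).sub hmean_int).congr ?_
      filter_upwards [hmem] with θ hθ
      have hnorm (ψ : ℝ) : ‖log 2 - log ‖(p : E3) - (sphericalPoint b (θ, ψ) : E3)‖‖ =
          log 2 - log ‖(p : E3) - (sphericalPoint b (θ, ψ) : E3)‖ :=
        norm_of_nonneg (sub_nonneg.2 (log_norm_sub_le_log_two _ _))
      simp only [hnorm]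
      rw [integral_sub (integrable_const _) (hint_circle θ hθ), hmean θ hθ]
      simp only [Pi.sub_apply, integral_const, measureReal_restrict_apply_univ, Real.volume_real_Ioo,
        smul_eq_mul]
      rw [max_eq_left (by linarith [pi_pos])]
      ring
  rw [← map_sphericalPoint b, setIntegral_map hcap hf.aestronglyMeasurable
      (measurable_sphericalPoint b).aemeasurable, restrict_preimage_geodesicBall b ha.2.le,
    integral_prod _ hint, integral_congr_ae (hmem.mono hmean), integral_const_mul,
    intervalIntegral.integral_of_le ha.1.le, integral_Ioc_eq_integral_Ioo, hμ,
    integral_withDensity_eq_integral_toReal_smul (by fun_prop) (by simp)]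
  congr 1
  refine setIntegral_congr_fun measurableSet_Ioo fun θ hθ ↦ ?_
  have hs := sin_nonneg_of_nonneg_of_le_pi hθ.1.le (hθ.2.trans ha.2).le
  simp [ENNReal.toReal_ofReal hs]

theorem stmt_4 (p₀ p : S2) (a : ℝ) (ha : a ∈ Set.Ioo 0 π)
    (hp : a ≤ Real.arccos ⟪(p₀ : E3), (p : E3)⟫) :
    1 / (4 * π * Real.sin (a / 2) ^ 2) *
        ∫ q in {q : S2 | Real.arccos ⟪(p₀ : E3), (q : E3)⟫ < a},
          Real.log ‖(p : E3) - (q : E3)‖ ∂σ2 =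
      Real.log ‖(p : E3) - (p₀ : E3)‖ - 1 / 2
        - Real.cot (a / 2) ^ 2 * Real.log (Real.cos (a / 2)) := by
  obtain ⟨b, hb⟩ := exists_orthonormalBasis_zero_eq p₀
  have hc : ⟪(p₀ : E3), (p : E3)⟫ < 1 := by
    by_contra! h
    rw [arccos_eq_zero.2 h] at hp
    exact hp.not_gt ha.1
  have hS : 0 < sin (a / 2) :=
    sin_pos_of_pos_of_lt_pi (by linarith [ha.1]) (by linarith [ha.1, ha.2])
  have hint := setIntegral_log_norm_sub b p ha (by rwa [hb])
  rw [hb] at hint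
  rw [hint, integral_sin_mul_log ha hc, log_norm_sub_of_sphere, real_inner_comm,
    show 2 * (1 - ⟪(p : E3), (p₀ : E3)⟫) = 2 - 2 * ⟪(p : E3), (p₀ : E3)⟫ by ring]
  field_simp
end

section
/- Let p₀, p ∈ S² and a ∈ (0,π), and suppose p ∈ B(p₀,a), i.e. arccos⟨p₀,p⟩ < a. Then (1/(4π sin²(a/2))) · ∫_{q ∈ B(p₀,a)} ln‖p − q‖ dσ(q) = ln 2 − 1/2 − (cot²(a/2)/2)·ln(1 − ‖p − p₀‖²/4) + ln sin(a/2). -/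
open MeasureTheory Real Filter
open scoped RealInnerProductSpace

lemma measurePreserving_orthonormalBasis_prod (b : OrthonormalBasis (Fin 3) ℝ E3) :
    MeasurePreserving (fun z : ℝ × (ℝ × ℝ) => z.1 • b 0 + z.2.1 • b 1 + z.2.2 • b 2)
      volume volume := by
  have h1 := ((MeasurePreserving.id (volume : Measure ℝ)).prod
    (volume_preserving_finTwoArrow ℝ).symm)
  have h2 := (volume_preserving_piFinSuccAbove (fun _ : Fin 3 => ℝ) 0).symm
  have h3 := b.measurePreserving_repr_symm.comp
    ((PiLp.volume_preserving_toLp (Fin 3)).comp (h2.comp h1))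
  have h4 : (fun z : ℝ × (ℝ × ℝ) => z.1 • b 0 + z.2.1 • b 1 + z.2.2 • b 2) =
      fun z => b.repr.symm (WithLp.toLp 2 ((MeasurableEquiv.piFinSuccAbove (fun _ => ℝ) 0).symm
        (Prod.map id MeasurableEquiv.finTwoArrow.symm z))) :=
    funext fun z => by
      rw [← b.sum_repr_symm, Fin.sum_univ_three]
      rfl
  rw [h4]
  exact h3

lemma lintegral_eq_lintegral_cylindrical (F : ℝ × (ℝ × ℝ) → ENNReal) (hF : Measurable F) :
    ∫⁻ z, F z = ∫⁻ φ in Set.Ioo (-π) π, ∫⁻ w : ℝ × ℝ in {w | 0 < w.2},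
      ENNReal.ofReal w.2 * F (w.1, w.2 * cos φ, w.2 * sin φ) := by
  have : ∀ z : ℝ, ∫⁻ w, F (z, w) = ∫⁻ r in Set.Ioi 0, ∫⁻ φ in Set.Ioo (-π) π,
      ENNReal.ofReal r * F (z, r * cos φ, r * sin φ) := by
    intro z
    rw [← lintegral_comp_polarCoord_symm, polarCoord_target, Measure.volume_eq_prod,
      ← Measure.prod_restrict, lintegral_prod]
    · rfl
    · apply Measurable.aemeasurable
      simp only [polarCoord_symm_apply, smul_eq_mul]
      fun_prop
  rw [Measure.volume_eq_prod, lintegral_prod _ hF.aemeasurable]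
  simp_rw [this]
  have hset : {w : ℝ × ℝ | 0 < w.2} = Set.univ ×ˢ Set.Ioi 0 := by ext; simp
  simp_rw [hset, Measure.volume_eq_prod ℝ ℝ, ← Measure.prod_restrict, Measure.restrict_univ]
  rw [← lintegral_prod (fun w : ℝ × ℝ => ∫⁻ φ in Set.Ioo (-π) π,
    ENNReal.ofReal w.2 * F (w.1, w.2 * cos φ, w.2 * sin φ)) (Measurable.aemeasurable
      (Measurable.lintegral_prod_right' (f := fun x : (ℝ × ℝ) × ℝ =>
        ENNReal.ofReal x.1.2 * F (x.1.1, x.1.2 * cos x.2, x.1.2 * sin x.2)) (by fun_prop))),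
    lintegral_lintegral_swap (by fun_prop)]

lemma setLIntegral_snd_pos_eq_lintegral_polar (G : ℝ × ℝ → ENNReal) (hG : Measurable G) :
    ∫⁻ w : ℝ × ℝ in {w | 0 < w.2}, ENNReal.ofReal w.2 * G w =
      ∫⁻ ρ in Set.Ioi (0 : ℝ), ENNReal.ofReal (ρ ^ 2) *
        ∫⁻ s in Set.Ioo (-1 : ℝ) 1, G (ρ * s, ρ * √(1 - s ^ 2)) := by
  have hm : MeasurableSet {w : ℝ × ℝ | 0 < w.2} := measurableSet_lt measurable_const measurable_snd
  rw [← lintegral_indicator hm, ← lintegral_comp_polarCoord_symm, polarCoord_target,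
    Measure.volume_eq_prod, ← Measure.prod_restrict, lintegral_prod]
  · refine setLIntegral_congr_fun measurableSet_Ioi fun ρ hρ => ?_
    have hρ : 0 < ρ := hρ
    have himg : cos '' Set.Ioo 0 π = Set.Ioo (-1) 1 := by
      ext x
      constructor
      · rintro ⟨θ, hθ, rfl⟩
        have h1 := strictAntiOn_cos (Set.left_mem_Icc.2 pi_pos.le) (⟨hθ.1.le, hθ.2.le⟩ : θ ∈ Set.Icc 0 π) hθ.1
        have h2 := strictAntiOn_cos (⟨hθ.1.le, hθ.2.le⟩ : θ ∈ Set.Icc 0 π) (Set.right_mem_Icc.2 pi_pos.le) hθ.2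
        simp only [cos_zero, cos_pi] at h1 h2
        exact ⟨h2, h1⟩
      · intro hx
        refine ⟨arccos x, ⟨arccos_pos.2 hx.2, ?_⟩, cos_arccos hx.1.le hx.2.le⟩
        exact lt_of_le_of_ne (arccos_le_pi x) fun h => absurd (arccos_eq_pi.1 h) (not_le.2 hx.1)
    have hsub : Set.Ioo 0 π ⊆ Set.Ioo (-π) π := Set.Ioo_subset_Ioo_left (by linarith [pi_pos])
    rw [← himg, lintegral_image_eq_lintegral_abs_deriv_mul measurableSet_Ioo
      (fun x _ => (hasDerivAt_cos x).hasDerivWithinAt)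
      (injOn_cos.mono Set.Ioo_subset_Icc_self), ← lintegral_const_mul' _ _ ENNReal.ofReal_ne_top,
      ← Set.inter_eq_self_of_subset_left hsub,
      ← Measure.restrict_restrict (measurableSet_Ioo (a := (0 : ℝ)) (b := π)),
      ← lintegral_indicator (measurableSet_Ioo (a := (0 : ℝ)) (b := π))]
    refine setLIntegral_congr_fun measurableSet_Ioo fun θ hθ => ?_
    simp only [polarCoord_symm_apply, smul_eq_mul]
    by_cases h : θ ∈ Set.Ioo 0 π
    · have hs := sin_pos_of_mem_Ioo h
      rw [Set.indicator_of_mem h, Set.indicator_of_mem (show _ ∈ {w : ℝ × ℝ | 0 < w.2} from mul_pos hρ hs),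
        abs_neg, abs_of_pos hs, ← abs_sin_eq_sqrt_one_sub_cos_sq, abs_of_pos hs, ← mul_assoc,
        ← mul_assoc, ← ENNReal.ofReal_mul hρ.le, ← ENNReal.ofReal_mul (sq_nonneg _)]
      congr 2
      ring
    · have hs : sin θ ≤ 0 := by
        refine sin_nonpos_of_nonpos_of_neg_pi_le ?_ hθ.1.le
        by_contra! h'
        exact h ⟨h', hθ.2⟩
      rw [Set.indicator_of_notMem h, Set.indicator_of_notMem, mul_zero]
      exact not_lt.2 (mul_nonpos_of_nonneg_of_nonpos hρ.le hs)
  · apply Measurable.aemeasurable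
    simp only [smul_eq_mul]
    refine Measurable.mul (by fun_prop)
      (Measurable.comp (Measurable.indicator ?_ hm) continuous_polarCoord_symm.measurable)
    fun_prop

lemma lintegral_polar_eq_toSphere {E : Type*} [NormedAddCommGroup E] [NormedSpace ℝ E]
    [MeasurableSpace E] [BorelSpace E] [FiniteDimensional ℝ E] [Nontrivial E]
    (μ : Measure E) [μ.IsAddHaarMeasure] (f : E → ENNReal) (hf : Measurable f) :
    ∫⁻ x in Metric.ball 0 1, f (‖x‖⁻¹ • x) ∂μ =
      (∫⁻ q, f q ∂μ.toSphere) * ENNReal.ofReal (1 / Module.finrank ℝ E) := by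
  have h := μ.measurePreserving_homeomorphUnitSphereProd.lintegral_comp_emb
    (Homeomorph.measurableEmbedding _)
    (fun z => f z.1 * (Set.Iio ⟨1, Set.mem_Ioi.2 one_pos⟩).indicator (fun _ => 1) z.2)
  rw [lintegral_prod_mul
    (f := fun q : Metric.sphere (0 : E) 1 => f q) (by fun_prop)
    (measurable_const.indicator measurableSet_Iio).aemeasurable,
    lintegral_indicator_const measurableSet_Iio, Measure.volumeIoiPow_apply_Iio] at h
  have hd : 1 ≤ Module.finrank ℝ E := Module.finrank_pos
  push_cast [hd] at h
  simp only [one_pow, sub_add_cancel, one_mul] at h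
  rw [← h, ← lintegral_indicator measurableSet_ball]
  conv_lhs => rw [← restrict_compl_singleton (μ := μ) 0,
    ← lintegral_subtype_comap (measurableSet_singleton _).compl]
  refine lintegral_congr fun x => ?_
  by_cases hx : ‖(x : E)‖ < 1
  · simp [Set.indicator, hx, ← Subtype.coe_lt_coe]
  · simp [Set.indicator, hx, ← Subtype.coe_lt_coe]

/-- The point of the unit sphere at height `s` and azimuth `φ` with respect to the basis `b`. -/
noncomputable def cylPoint (b : OrthonormalBasis (Fin 3) ℝ E3) (s φ : ℝ) : E3 :=
  s • b 0 + (√(1 - s ^ 2) * cos φ) • b 1 + (√(1 - s ^ 2) * sin φ) • b 2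

lemma measurable_cylPoint (b : OrthonormalBasis (Fin 3) ℝ E3) :
    Measurable fun z : ℝ × ℝ => cylPoint b z.1 z.2 := by
  unfold cylPoint
  fun_prop

lemma inner_cylPoint (b : OrthonormalBasis (Fin 3) ℝ E3) (x : E3) (s φ : ℝ) :
    ⟪x, cylPoint b s φ⟫ = s * ⟪b 0, x⟫ + √(1 - s ^ 2) * cos φ * ⟪b 1, x⟫
      + √(1 - s ^ 2) * sin φ * ⟪b 2, x⟫ := by
  simp only [cylPoint, inner_add_right, inner_smul_right, real_inner_comm x]

lemma norm_cylPoint (b : OrthonormalBasis (Fin 3) ℝ E3) {s : ℝ} (hs : s ∈ Set.Ioo (-1 : ℝ) 1)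
    (φ : ℝ) : ‖cylPoint b s φ‖ = 1 := by
  have h : ‖cylPoint b s φ‖ ^ 2 = 1 := by
    rw [← b.sum_sq_norm_inner_right, Fin.sum_univ_three]
    simp only [inner_cylPoint, b.inner_eq_ite, Real.norm_eq_abs, sq_abs]
    have h1 : √(1 - s ^ 2) ^ 2 = 1 - s ^ 2 := sq_sqrt (by nlinarith [hs.1, hs.2])
    simp
    linear_combination (cos φ ^ 2 + sin φ ^ 2) * h1 + (1 - s ^ 2) * sin_sq_add_cos_sq φ
  exact (pow_eq_one_iff_of_nonneg (norm_nonneg _) two_ne_zero).1 h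

lemma lintegral_sphere_eq_lintegral_cylPoint (b : OrthonormalBasis (Fin 3) ℝ E3)
    (f : E3 → ENNReal) (hf : Measurable f) :
    ∫⁻ q, f q ∂σ2 = ∫⁻ s in Set.Ioo (-1 : ℝ) 1, ∫⁻ φ in Set.Ioo (-π) π, f (cylPoint b s φ) := by
  have h := lintegral_polar_eq_toSphere (volume : Measure E3) f hf
  have hF : Measurable ((Metric.ball (0 : E3) 1).indicator fun x => f (‖x‖⁻¹ • x)) :=
    Measurable.indicator (by fun_prop) measurableSet_ball
  rw [← lintegral_indicator measurableSet_ball,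
    ← (measurePreserving_orthonormalBasis_prod b).lintegral_comp hF,
    lintegral_eq_lintegral_cylindrical
      (fun z => (Metric.ball (0 : E3) 1).indicator (fun x => f (‖x‖⁻¹ • x))
        (z.1 • b 0 + z.2.1 • b 1 + z.2.2 • b 2)) (hF.comp (by fun_prop))] at h
  have hK : ∫⁻ ρ in Set.Ioi (0 : ℝ), (Set.Iio 1).indicator (fun ρ => ENNReal.ofReal (ρ ^ 2)) ρ
      = ENNReal.ofReal (1 / 3) := by
    rw [setLIntegral_indicator measurableSet_Iio, Set.inter_comm, Set.Ioi_inter_Iio,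
      ← ofReal_integral_eq_lintegral_ofReal, ← integral_Ioc_eq_integral_Ioo,
      ← intervalIntegral.integral_of_le zero_le_one]
    · norm_num
    · exact (Continuous.integrableOn_Icc (by fun_prop)).mono_set Set.Ioo_subset_Icc_self
    · exact ae_of_all _ fun ρ => sq_nonneg ρ
  have hφ : ∀ φ : ℝ, ∫⁻ w : ℝ × ℝ in {w | 0 < w.2}, ENNReal.ofReal w.2 *
      (Metric.ball (0 : E3) 1).indicator (fun x => f (‖x‖⁻¹ • x))
        (w.1 • b 0 + (w.2 * cos φ) • b 1 + (w.2 * sin φ) • b 2) =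
      ENNReal.ofReal (1 / 3) * ∫⁻ s in Set.Ioo (-1 : ℝ) 1, f (cylPoint b s φ) := by
    intro φ
    rw [setLIntegral_snd_pos_eq_lintegral_polar (fun w =>
      (Metric.ball (0 : E3) 1).indicator (fun x => f (‖x‖⁻¹ • x))
        (w.1 • b 0 + (w.2 * cos φ) • b 1 + (w.2 * sin φ) • b 2)) (hF.comp (by fun_prop)),
      ← hK, ← lintegral_mul_const]
    · refine setLIntegral_congr_fun measurableSet_Ioi fun ρ hρ => ?_
      have hρ : 0 < ρ := hρ
      have key : ∀ s ∈ Set.Ioo (-1 : ℝ) 1,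
          (Metric.ball (0 : E3) 1).indicator (fun x => f (‖x‖⁻¹ • x))
            ((ρ * s) • b 0 + (ρ * √(1 - s ^ 2) * cos φ) • b 1
              + (ρ * √(1 - s ^ 2) * sin φ) • b 2) =
            if ρ < 1 then f (cylPoint b s φ) else 0 := by
        intro s hs
        have : (ρ * s) • b 0 + (ρ * √(1 - s ^ 2) * cos φ) • b 1
              + (ρ * √(1 - s ^ 2) * sin φ) • b 2 = ρ • cylPoint b s φ := by
          simp only [cylPoint, smul_add, smul_smul, mul_assoc]
        have hn : ‖ρ • cylPoint b s φ‖ = ρ := by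
          rw [norm_smul, norm_cylPoint b hs, mul_one, norm_of_nonneg hρ.le]
        have hmem : ρ • cylPoint b s φ ∈ Metric.ball (0 : E3) 1 ↔ ρ < 1 := by
          rw [mem_ball_zero_iff, hn]
        rw [this]
        by_cases h1 : ρ < 1
        · rw [Set.indicator_of_mem (hmem.2 h1), if_pos h1, hn, inv_smul_smul₀ hρ.ne']
        · rw [Set.indicator_of_notMem (mt hmem.1 h1), if_neg h1]
      simp only []
      rw [setLIntegral_congr_fun measurableSet_Ioo key]
      by_cases h1 : ρ < 1
      · simp [h1]
      · simp [h1]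
    · exact Measurable.indicator (by fun_prop) measurableSet_Iio
  have hm := measurable_cylPoint b
  simp only [hφ] at h
  rw [lintegral_const_mul' _ _ ENNReal.ofReal_ne_top, mul_comm, finrank_euclideanSpace_fin] at h
  have h3 := (ENNReal.mul_left_inj (by simp) ENNReal.ofReal_ne_top).1 h
  rw [σ2, ← h3, lintegral_lintegral_swap]
  exact (hf.comp (hm.comp measurable_swap)).aemeasurable

lemma integrableOn_cap_and_integral_cap (b : OrthonormalBasis (Fin 3) ℝ E3) {F : E3 → ℝ}
    (hF : Measurable F) (h0 : ∀ x, ‖x‖ = 1 → 0 ≤ F x) {c : ℝ} (hc : -1 ≤ c) {I : ℝ → ℝ}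
    (hs : ∀ᵐ s ∂volume.restrict (Set.Ioo c 1),
      IntegrableOn (fun φ => F (cylPoint b s φ)) (Set.Ioo (-π) π) ∧
        ∫ φ in Set.Ioo (-π) π, F (cylPoint b s φ) = I s)
    (hI : IntegrableOn I (Set.Ioo c 1)) :
    IntegrableOn (fun q : S2 => F q) {q : S2 | c < ⟪b 0, (q : E3)⟫} σ2 ∧
      ∫ q in {q : S2 | c < ⟪b 0, (q : E3)⟫}, F q ∂σ2 = ∫ s in Set.Ioo c 1, I s := by
  have hcap : MeasurableSet {x : E3 | c < ⟪b 0, x⟫} :=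
    measurableSet_lt measurable_const (by fun_prop)
  have hcap' : MeasurableSet {q : S2 | c < ⟪b 0, (q : E3)⟫} := measurable_subtype_coe hcap
  have hFm : Measurable fun q : S2 => F q := hF.comp measurable_subtype_coe
  have hinner : ∀ s φ, ⟪b 0, cylPoint b s φ⟫ = s := by
    intro s φ
    simp [inner_cylPoint, b.inner_eq_ite]
  have hnn : ∀ᵐ s ∂volume.restrict (Set.Ioo c 1), 0 ≤ I s := by
    filter_upwards [hs, ae_restrict_mem measurableSet_Ioo] with s h hsI
    rw [← h.2]
    exact integral_nonneg fun φ => h0 _ (norm_cylPoint b ⟨hc.trans_lt hsI.1, hsI.2⟩ φ)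
  have key : ∫⁻ q in {q : S2 | c < ⟪b 0, (q : E3)⟫}, ENNReal.ofReal (F q) ∂σ2 =
      ENNReal.ofReal (∫ s in Set.Ioo c 1, I s) := by
    have h := lintegral_sphere_eq_lintegral_cylPoint b
      ({x : E3 | c < ⟪b 0, x⟫}.indicator fun x => ENNReal.ofReal (F x))
      (hF.ennreal_ofReal.indicator hcap)
    have h1 : ∀ s, ∫⁻ φ in Set.Ioo (-π) π,
        ({x : E3 | c < ⟪b 0, x⟫}.indicator fun x => ENNReal.ofReal (F x)) (cylPoint b s φ) =
        (Set.Ioi c).indicator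
          (fun s => ∫⁻ φ in Set.Ioo (-π) π, ENNReal.ofReal (F (cylPoint b s φ))) s := by
      intro s
      by_cases hsc : c < s
      · simp [Set.indicator, hinner, hsc]
      · simp [Set.indicator, hinner, hsc]
    simp_rw [h1] at h
    rw [setLIntegral_indicator measurableSet_Ioi, Set.Ioi_inter_Ioo, sup_eq_left.2 hc] at h
    rw [← lintegral_indicator hcap', ofReal_integral_eq_lintegral_ofReal hI hnn]
    refine Eq.trans ?_ (h.trans ?_)
    · rfl
    · refine lintegral_congr_ae ?_
      filter_upwards [hs, ae_restrict_mem measurableSet_Ioo] with s h hsI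
      rw [← h.2, ofReal_integral_eq_lintegral_ofReal h.1]
      exact ae_of_all _ fun φ => h0 _ (norm_cylPoint b ⟨hc.trans_lt hsI.1, hsI.2⟩ φ)
  have hFnn : ∀ q : S2, 0 ≤ F q := fun q => h0 _ (mem_sphere_zero_iff_norm.1 q.2)
  refine ⟨⟨hFm.aestronglyMeasurable, ?_⟩, ?_⟩
  · rw [hasFiniteIntegral_iff_ofReal (ae_of_all _ hFnn), key]
    exact ENNReal.ofReal_lt_top
  · rw [integral_eq_lintegral_of_nonneg_ae (ae_of_all _ hFnn) hFm.aestronglyMeasurable, key,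
      ENNReal.toReal_ofReal (integral_nonneg_of_ae hnn)]

lemma integrableOn_circleMap_and_integral_eq {f : ℂ → ℝ} {R : ℝ} (hf : CircleIntegrable f 0 R) :
    IntegrableOn (fun φ => f (circleMap 0 R φ)) (Set.Ioo (-π) π) ∧
      ∫ φ in Set.Ioo (-π) π, f (circleMap 0 R φ) = 2 * π * circleAverage f 0 R := by
  have hper : Function.Periodic (fun φ => f (circleMap 0 R φ)) (2 * π) :=
    (periodic_circleMap 0 R).comp f
  have hle : -π ≤ π := by linarith [pi_pos]
  constructor
  · have h := hper.intervalIntegrable₀ two_pi_pos.ne' hf (-π) π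
    exact ((intervalIntegrable_iff_integrableOn_Ioc_of_le hle).1 h).mono_set
      Set.Ioo_subset_Ioc_self
  · rw [← integral_Ioc_eq_integral_Ioo, ← intervalIntegral.integral_of_le hle, circleAverage_def,
      smul_eq_mul, mul_inv_cancel_left₀ two_pi_pos.ne']
    have h := hper.intervalIntegral_add_eq (-π) 0
    rwa [zero_add, show -π + 2 * π = π by ring] at h

lemma norm_sub_cylPoint_sq (b : OrthonormalBasis (Fin 3) ℝ E3) {p : E3} (hp : ‖p‖ = 1)
    (ht : -1 < ⟪b 0, p⟫) {s : ℝ} (hs : s ∈ Set.Ioo (-1 : ℝ) 1) (φ : ℝ) :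
    ‖p - cylPoint b s φ‖ ^ 2 = (1 + s) * (1 + ⟪b 0, p⟫) *
      ‖circleMap 0 (√(1 - s ^ 2) / (1 + s)) φ -
        ⟨⟪b 1, p⟫ / (1 + ⟪b 0, p⟫), ⟪b 2, p⟫ / (1 + ⟪b 0, p⟫)⟩‖ ^ 2 := by
  have h1 : √(1 - s ^ 2) ^ 2 = 1 - s ^ 2 := sq_sqrt (by nlinarith [hs.1, hs.2])
  have h2 := b.sum_sq_norm_inner_right p
  simp only [Fin.sum_univ_three, Real.norm_eq_abs, sq_abs, hp] at h2
  have h3 : 0 < 1 + s := by linarith [hs.1]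
  rw [norm_sub_sq_real, hp, norm_cylPoint b hs, inner_cylPoint, Complex.sq_norm,
    Complex.normSq_apply]
  have h4 : 0 < 1 + ⟪b 0, p⟫ := by linarith
  simp only [circleMap, Complex.sub_re, Complex.sub_im, Complex.add_re, Complex.zero_re,
    Complex.zero_im, Complex.add_im, Complex.re_ofReal_mul, Complex.im_ofReal_mul,
    Complex.exp_ofReal_mul_I_re, Complex.exp_ofReal_mul_I_im]
  set t := ⟪b 0, p⟫
  set u := ⟪b 1, p⟫
  set v := ⟪b 2, p⟫
  set r := √(1 - s ^ 2)
  have h5 := sin_sq_add_cos_sq φ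
  have h6 : r ^ 2 = (1 - s) * (1 + s) := by rw [h1]; ring
  have h7 : u ^ 2 + v ^ 2 = (1 - t) * (1 + t) := by linear_combination h2
  field_simp
  linear_combination (-(1 + t) ^ 2 * r ^ 2) * h5 - (1 + t) ^ 2 * h6 - (1 + s) ^ 2 * h7

lemma integral_log_norm_sub_cylPoint (b : OrthonormalBasis (Fin 3) ℝ E3) {p : E3} (hp : ‖p‖ = 1)
    (ht : -1 < ⟪b 0, p⟫) {s : ℝ} (hs : s ∈ Set.Ioo (-1 : ℝ) 1) (hst : s ≠ ⟪b 0, p⟫) :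
    IntegrableOn (fun φ => log ‖p - cylPoint b s φ‖) (Set.Ioo (-π) π) ∧
      ∫ φ in Set.Ioo (-π) π, log ‖p - cylPoint b s φ‖ =
        π * (log (1 + max s ⟪b 0, p⟫) + log (1 - min s ⟪b 0, p⟫)) := by
  have h3 : 0 < 1 + s := by linarith [hs.1]
  have h3' : 0 < 1 - s := by linarith [hs.2]
  have h4 : 0 < 1 + ⟪b 0, p⟫ := by linarith
  have hne : ∀ φ, p - cylPoint b s φ ≠ 0 := by
    intro φ h
    apply hst
    rw [sub_eq_zero.1 h]
    simp [inner_cylPoint, b.inner_eq_ite]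
  set t := ⟪b 0, p⟫
  set R := √(1 - s ^ 2) / (1 + s)
  set ζ : ℂ := ⟨⟪b 1, p⟫ / (1 + t), ⟪b 2, p⟫ / (1 + t)⟩
  have h1 : √(1 - s ^ 2) ^ 2 = 1 - s ^ 2 := sq_sqrt (by nlinarith [hs.1, hs.2])
  have hR : 0 < R := div_pos (sqrt_pos.2 (by nlinarith [hs.1, hs.2])) h3
  have hR2 : R ^ 2 = (1 - s) / (1 + s) := by
    simp only [R]
    field_simp
    linear_combination h1
  have hζ2 : ‖ζ‖ ^ 2 = (1 - t) / (1 + t) := by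
    have h2 := b.sum_sq_norm_inner_right p
    simp only [Fin.sum_univ_three, Real.norm_eq_abs, sq_abs, hp] at h2
    rw [Complex.sq_norm, Complex.normSq_apply]
    simp only [ζ]
    field_simp
    linear_combination h2
  have hlog : ∀ φ, log ‖p - cylPoint b s φ‖ =
      (log (1 + s) + log (1 + t)) / 2 + log ‖circleMap 0 R φ - ζ‖ := by
    intro φ
    have hsq := norm_sub_cylPoint_sq b hp ht hs φ
    have hpos : 0 < ‖p - cylPoint b s φ‖ ^ 2 := by
      have := norm_pos_iff.2 (hne φ)
      positivity
    have hne2 : ‖circleMap 0 R φ - ζ‖ ^ 2 ≠ 0 := fun h => by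
      rw [hsq, h, mul_zero] at hpos
      exact hpos.false
    have := congrArg log hsq
    rw [log_mul (by positivity) hne2, log_mul h3.ne' h4.ne', log_pow, log_pow] at this
    push_cast at this
    linarith
  have hci : CircleIntegrable (log ‖· - ζ‖) 0 R := circleIntegrable_log_norm_sub_const R
  obtain ⟨hint, hval⟩ := integrableOn_circleMap_and_integral_eq hci
  have hconst : IntegrableOn (fun _ : ℝ => (log (1 + s) + log (1 + t)) / 2)
    (Set.Ioo (-π) π) := integrableOn_const (by simp)
  simp_rw [hlog]
  refine ⟨hconst.add hint, ?_⟩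
  rw [integral_add hconst hint, hval, setIntegral_const,
    circleAverage_log_norm_sub_const_eq_log_radius_add_posLog hR.ne', zero_sub, norm_neg]
  have hvol : volume.real (Set.Ioo (-π) π) = 2 * π := by
    rw [Measure.real, Real.volume_Ioo, ENNReal.toReal_ofReal (by linarith [pi_pos])]
    ring
  have hlogR : log R = (log (1 - s) - log (1 + s)) / 2 := by
    have := congrArg log hR2
    rw [log_pow, log_div h3'.ne' h3.ne'] at this
    push_cast at this
    linarith
  rw [hvol, smul_eq_mul]
  rcases hst.lt_or_gt with h | h
  · rw [max_eq_right h.le, min_eq_left h.le]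
    have : ‖ζ‖ ≤ R := by
      refine le_of_sq_le_sq ?_ hR.le
      rw [hζ2, hR2, div_le_div_iff₀ h4 h3]
      nlinarith
    rw [posLog_eq_zero_iff _ |>.2, hlogR]
    · ring
    · rw [abs_of_nonneg (by positivity), inv_mul_le_one₀ hR]
      exact this
  · rw [max_eq_left h.le, min_eq_right h.le]
    have : R ≤ ‖ζ‖ := by
      refine le_of_sq_le_sq ?_ (norm_nonneg _)
      rw [hζ2, hR2, div_le_div_iff₀ h3 h4]
      nlinarith
    have h5 : 0 < 1 - t := by linarith
    have hlogζ : log ‖ζ‖ = (log (1 - t) - log (1 + t)) / 2 := by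
      have := congrArg log hζ2
      rw [log_pow, log_div h5.ne' h4.ne'] at this
      push_cast at this
      linarith
    rw [posLog_eq_log, log_mul (by positivity) (hR.trans_le this).ne', log_inv, hlogζ]
    · ring
    · rw [abs_of_nonneg (by positivity), ← div_eq_inv_mul, one_le_div₀ hR]
      exact this

lemma integral_log_one_add_max_add_log_one_sub_min {c t : ℝ} (hct : c < t) (ht : t ≤ 1) :
    IntegrableOn (fun s => log (1 + max s t) + log (1 - min s t)) (Set.Ioo c 1) ∧
      ∫ s in Set.Ioo c 1, (log (1 + max s t) + log (1 - min s t)) =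
        (1 - c) * log (1 - c) - (1 - c) + 2 * log 2 - (1 + c) * log (1 + t) := by
  have hlo : Set.EqOn (fun s => log (1 + t) + log (1 - s))
      (fun s => log (1 + max s t) + log (1 - min s t)) (Set.uIcc c t) := by
    intro s hs
    rw [Set.uIcc_of_le hct.le] at hs
    simp only [max_eq_right hs.2, min_eq_left hs.2]
  have hhi : Set.EqOn (fun s => log (1 + s) + log (1 - t))
      (fun s => log (1 + max s t) + log (1 - min s t)) (Set.uIcc t 1) := by
    intro s hs
    rw [Set.uIcc_of_le ht] at hs
    simp only [max_eq_left hs.1, min_eq_right hs.1]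
  have hi1 : IntervalIntegrable (fun s => log (1 - s)) volume c t := by
    have h := (intervalIntegral.intervalIntegrable_log' (a := 1 - c) (b := 1 - t)).comp_sub_left 1
    simpa using h
  have hi2 : IntervalIntegrable (fun s => log (1 + s)) volume t 1 := by
    have h := (intervalIntegral.intervalIntegrable_log' (a := 1 + t) (b := 1 + 1)).comp_add_left 1
    simpa using h
  have h1 := ((intervalIntegrable_const (c := log (1 + t))).add hi1).congr
    (hlo.mono Set.uIoc_subset_uIcc)
  have h2 := (hi2.add (intervalIntegrable_const (c := log (1 - t)))).congr
    (hhi.mono Set.uIoc_subset_uIcc)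
  have hc1 : c ≤ 1 := hct.le.trans ht
  constructor
  · exact ((intervalIntegrable_iff_integrableOn_Ioc_of_le hc1).1 (h1.trans h2)).mono_set
      Set.Ioo_subset_Ioc_self
  · rw [← integral_Ioc_eq_integral_Ioo, ← intervalIntegral.integral_of_le hc1,
      ← intervalIntegral.integral_add_adjacent_intervals h1 h2,
      ← intervalIntegral.integral_congr hlo, ← intervalIntegral.integral_congr hhi,
      intervalIntegral.integral_add intervalIntegrable_const hi1,
      intervalIntegral.integral_add hi2 intervalIntegrable_const,
      intervalIntegral.integral_comp_sub_left (fun x => log x),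
      intervalIntegral.integral_comp_add_left (fun x => log x)]
    simp only [integral_log, intervalIntegral.integral_const, smul_eq_mul]
    rw [show (1 : ℝ) + 1 = 2 by norm_num]
    ring

lemma setIntegral_cap_log_norm_sub (b : OrthonormalBasis (Fin 3) ℝ E3) {p : E3} (hp : ‖p‖ = 1)
    {c : ℝ} (hc : -1 ≤ c) (hcp : c < ⟪b 0, p⟫) :
    ∫ q in {q : S2 | c < ⟪b 0, (q : E3)⟫}, log ‖p - q‖ ∂σ2 =
      π * ((1 - c) * log (1 - c) - (1 - c) + 2 * log 2 - (1 + c) * log (1 + ⟪b 0, p⟫)) := by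
  have ht1 : ⟪b 0, p⟫ ≤ 1 := by
    have := real_inner_le_norm (b 0) p
    rwa [hp, b.norm_eq_one, mul_one] at this
  obtain ⟨hJ, hJv⟩ := integral_log_one_add_max_add_log_one_sub_min hcp ht1
  set t := ⟪b 0, p⟫
  have hpi : -π ≤ π := by linarith [pi_pos]
  have hvol : volume.real (Set.Ioo (-π) π) = 2 * π := by
    rw [volume_real_Ioo_of_le hpi]
    ring
  have hconst : IntegrableOn (fun _ : ℝ => log 2) (Set.Ioo (-π) π) :=
    integrableOn_const (by simp)
  have hconst' : IntegrableOn (fun _ : ℝ => 2 * π * log 2) (Set.Ioo c 1) :=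
    integrableOn_const (by simp)
  obtain ⟨hA, hAv⟩ := integrableOn_cap_and_integral_cap b (F := fun _ => log 2)
    measurable_const (fun _ _ => (log_pos one_lt_two).le) hc (I := fun _ => 2 * π * log 2)
    (ae_of_all _ fun s => ⟨hconst, by rw [setIntegral_const, hvol, smul_eq_mul]⟩) hconst'
  obtain ⟨hB, hBv⟩ := integrableOn_cap_and_integral_cap b (F := fun x => log 2 - log ‖p - x‖)
    (by fun_prop)
    (fun x hx => by
      have h : ‖p - x‖ ≤ 2 := (norm_sub_le p x).trans (by rw [hp, hx]; norm_num)
      rcases (norm_nonneg (p - x)).eq_or_lt with h0 | h0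
      · simpa [← h0] using (log_pos one_lt_two).le
      · exact sub_nonneg.2 (log_le_log h0 h)) hc
    (I := fun s => 2 * π * log 2 - π * (log (1 + max s t) + log (1 - min s t)))
    (by
      filter_upwards [ae_restrict_mem measurableSet_Ioo,
        ae_restrict_of_ae (Measure.ae_ne volume t)] with s hs hst
      obtain ⟨h1, h2⟩ := integral_log_norm_sub_cylPoint b hp (hc.trans_lt hcp)
        ⟨hc.trans_lt hs.1, hs.2⟩ hst
      refine ⟨hconst.sub h1, ?_⟩
      rw [integral_sub hconst h1, h2, setIntegral_const, hvol, smul_eq_mul])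
    (hconst'.sub (hJ.const_mul π))
  have h : (fun q : S2 => log ‖p - q‖) = fun q : S2 => log 2 - (log 2 - log ‖p - q‖) :=
    funext fun q => (sub_sub_cancel _ _).symm
  rw [h, integral_sub hA hB, hAv, hBv, integral_sub hconst' (hJ.const_mul π),
    sub_sub_cancel, integral_const_mul, hJv]

theorem stmt_5 (p₀ p : S2) (a : ℝ) (ha : a ∈ Set.Ioo 0 π)
    (hp : Real.arccos ⟪(p₀ : E3), (p : E3)⟫ < a) :
    1 / (4 * π * Real.sin (a / 2) ^ 2) *
        ∫ q in {q : S2 | Real.arccos ⟪(p₀ : E3), (q : E3)⟫ < a},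
          Real.log ‖(p : E3) - (q : E3)‖ ∂σ2 =
      Real.log 2 - 1 / 2
        - Real.cot (a / 2) ^ 2 / 2 * Real.log (1 - ‖(p : E3) - (p₀ : E3)‖ ^ 2 / 4)
        + Real.log (Real.sin (a / 2)) := by
  have hn : ∀ q : S2, ‖(q : E3)‖ = 1 := fun q => mem_sphere_zero_iff_norm.1 q.2
  have hcap : ∀ q : S2, arccos ⟪(p₀ : E3), (q : E3)⟫ < a ↔ cos a < ⟪(p₀ : E3), (q : E3)⟫ := by
    intro q
    have h := abs_le.1 (abs_real_inner_le_norm (p₀ : E3) q)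
    simp only [hn, mul_one] at h
    conv_lhs => rw [← arccos_cos ha.1.le ha.2.le]
    exact strictAntiOn_arccos.lt_iff_gt h ⟨neg_one_le_cos a, cos_le_one a⟩
  obtain ⟨b, hb⟩ : ∃ b : OrthonormalBasis (Fin 3) ℝ E3, b 0 = p₀ := by
    obtain ⟨b, hb⟩ := Orthonormal.exists_orthonormalBasis_extension_of_card_eq
      (𝕜 := ℝ) (E := E3) (ι := Fin 3) (by simp) (v := fun _ => (p₀ : E3)) (s := {0})
      ⟨fun i => hn p₀, fun i j hij => absurd (Subsingleton.elim i j) hij⟩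
    exact ⟨b, hb 0 rfl⟩
  rw [hcap] at hp
  simp_rw [hcap]
  have key := setIntegral_cap_log_norm_sub b (hn p) (neg_one_le_cos a) (hb ▸ hp)
  rw [hb] at key
  rw [key]
  have hs : 0 < sin (a / 2) :=
    sin_pos_of_pos_of_lt_pi (by linarith [ha.1]) (by linarith [ha.1, ha.2])
  have hcos : cos a = 1 - 2 * sin (a / 2) ^ 2 := by
    rw [← cos_two_mul_eq_one_sub, mul_div_cancel₀ a two_ne_zero]
  have ht : 0 < 1 + ⟪(p₀ : E3), (p : E3)⟫ := by linarith [neg_one_le_cos a]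
  have h1 : 1 - ‖(p : E3) - p₀‖ ^ 2 / 4 = (1 + ⟪(p₀ : E3), (p : E3)⟫) / 2 := by
    rw [norm_sub_sq_real, hn, hn, real_inner_comm]
    ring
  have hcot : cot (a / 2) ^ 2 = (1 - sin (a / 2) ^ 2) / sin (a / 2) ^ 2 := by
    rw [cot_eq_cos_div_sin, div_pow, cos_sq']
  rw [h1, hcot, log_div ht.ne' two_ne_zero, hcos,
    show 1 - (1 - 2 * sin (a / 2) ^ 2) = 2 * sin (a / 2) ^ 2 by ring,
    log_mul two_ne_zero (by positivity), log_pow]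
  have := pi_pos
  field_simp
  push_cast
  ring
end

section
/- Let n ≥ 2 be an integer. For every p ∈ Sⁿ, the function q ↦ g_n(‖p − q‖) has zero mean over the sphere: ∫_{q ∈ Sⁿ} g_n(‖p − q‖) dσ(q) = 0. -/
open MeasureTheory Real Filter
open scoped RealInnerProductSpace

noncomputable def poch (x : ℝ) (k : ℕ) : ℝ := ∏ i ∈ Finset.range k, (x + i)

noncomputable def incBeta (x α β : ℝ) : ℝ := ∫ t in (0:ℝ)..x, t ^ (α - 1) * (1 - t) ^ (β - 1)

noncomputable def sphereVol (n : ℕ) : ℝ :=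
  2 * Real.pi ^ (((n : ℝ) + 1) / 2) / Real.Gamma (((n : ℝ) + 1) / 2)

noncomputable def green (n : ℕ) (t : ℝ) : ℝ :=
  2 / (n * sphereVol n) * ∑' k : ℕ,
    poch n k / (((k : ℝ) + 1) * poch ((n : ℝ) / 2 + 1) k) *
      ((1 - t ^ 2 / 4) ^ (k + 1)
        - incBeta 1 ((n : ℝ) / 2) ((n : ℝ) / 2 + k + 1) / incBeta 1 ((n : ℝ) / 2) ((n : ℝ) / 2))

noncomputable def Kfun (n : ℕ) (a : ℝ) : ℝ :=
  2 / (n * sphereVol n) * ∑' k : ℕ,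
    poch n k / (poch ((n : ℝ) / 2 + 1) k * ((k : ℝ) + 1)) *
      (incBeta (Real.sin (a / 2) ^ 2) ((n : ℝ) / 2 + k + 1) ((n : ℝ) / 2) /
        incBeta (Real.sin (a / 2) ^ 2) ((n : ℝ) / 2) ((n : ℝ) / 2))

noncomputable def ballVol (n : ℕ) (a : ℝ) : ℝ :=
  sphereVol (n - 1) * ∫ r in (0:ℝ)..a, Real.sin r ^ (n - 1)

noncomputable def sphereMeasure (n : ℕ) :
    Measure (Metric.sphere (0 : EuclideanSpace ℝ (Fin (n + 1))) 1) :=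
  (volume : Measure (EuclideanSpace ℝ (Fin (n + 1)))).toSphere


section GaussianMoments

variable {E : Type*} [NormedAddCommGroup E] [InnerProductSpace ℝ E] [FiniteDimensional ℝ E]
  [MeasurableSpace E] [BorelSpace E]

theorem integrableOn_pow_mul_exp_neg_sq (k : ℕ) :
    IntegrableOn (fun r : ℝ => r ^ k * Real.exp (-r ^ 2)) (Set.Ioi 0) := by
  have h := integrableOn_rpow_mul_exp_neg_rpow (p := 2) (s := k)
    (by have : (0 : ℝ) ≤ k := k.cast_nonneg
        linarith) (by norm_num)
  refine h.congr_fun (fun r _ => ?_) measurableSet_Ioi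
  simp only [Real.rpow_natCast]
  norm_num

theorem integral_pow_mul_exp_neg_sq (k : ℕ) :
    ∫ r in Set.Ioi (0 : ℝ), r ^ k * Real.exp (-r ^ 2) = 1 / 2 * Real.Gamma ((k + 1) / 2) := by
  have h := integral_rpow_mul_exp_neg_rpow (p := 2) (q := k) (by norm_num)
    (by have : (0 : ℝ) ≤ k := k.cast_nonneg
        linarith)
  rw [← h]
  refine setIntegral_congr_fun measurableSet_Ioi fun r _ => ?_
  simp only [Real.rpow_natCast]
  norm_num

theorem integral_pow_mul_exp_neg_sq_pos (k : ℕ) :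
    0 < ∫ r in Set.Ioi (0 : ℝ), r ^ k * Real.exp (-r ^ 2) := by
  rw [integral_pow_mul_exp_neg_sq]
  have := Real.Gamma_pos_of_pos (s := ((k : ℝ) + 1) / 2) (by positivity)
  positivity

theorem integral_pow_add_two_mul_exp_neg_sq (k : ℕ) :
    2 * ∫ r in Set.Ioi (0 : ℝ), r ^ (k + 2) * Real.exp (-r ^ 2) =
      (k + 1) * ∫ r in Set.Ioi (0 : ℝ), r ^ k * Real.exp (-r ^ 2) := by
  rw [integral_pow_mul_exp_neg_sq, integral_pow_mul_exp_neg_sq]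
  have : (((k + 2 : ℕ) : ℝ) + 1) / 2 = ((k : ℝ) + 1) / 2 + 1 := by push_cast; ring
  rw [this, Real.Gamma_add_one (by positivity)]
  ring

theorem integrable_inner_pow_mul_exp_neg_norm_sq [Nontrivial E] (p : E) (m : ℕ) :
    Integrable (fun x : E => ⟪p, x⟫ ^ m * Real.exp (-‖x‖ ^ 2)) := by
  have h : Integrable (fun x : E => ‖x‖ ^ m * Real.exp (-‖x‖ ^ 2)) := by
    rw [integrable_fun_norm_addHaar volume (f := fun r : ℝ => r ^ m * Real.exp (-r ^ 2))]
    refine (integrableOn_pow_mul_exp_neg_sq (Module.finrank ℝ E - 1 + m)).congr_fun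
      (fun r _ => ?_) measurableSet_Ioi
    simp only [smul_eq_mul, pow_add, mul_assoc]
  refine (h.const_mul (‖p‖ ^ m)).mono' (by fun_prop) (ae_of_all _ fun x => ?_)
  rw [norm_mul, norm_pow, Real.norm_of_nonneg (Real.exp_pos _).le, ← mul_assoc, ← mul_pow]
  gcongr
  exact norm_inner_le_norm p x

theorem integral_inner_pow_mul_exp_neg_norm_sq_recurrence [Nontrivial E] {p : E} (hp : ‖p‖ = 1)
    (m : ℕ) :
    2 * ∫ x : E, ⟪p, x⟫ ^ (m + 1) * Real.exp (-‖x‖ ^ 2) =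
      m * ∫ x : E, ⟪p, x⟫ ^ (m - 1) * Real.exp (-‖x‖ ^ 2) := by
  have hf (x : E) : HasFDerivAt (fun x : E => ⟪p, x⟫ ^ m)
      ((m * ⟪p, x⟫ ^ (m - 1)) • innerSL ℝ p) x := by
    simpa using ((innerSL ℝ p).hasFDerivAt (x := x)).pow m
  have hg (x : E) : HasFDerivAt (fun x : E => Real.exp (-‖x‖ ^ 2))
      (Real.exp (-‖x‖ ^ 2) • (-((2 : ℕ) • innerSL ℝ x) : E →L[ℝ] ℝ)) x :=
    ((hasStrictFDerivAt_norm_sq x).hasFDerivAt.fun_neg).exp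
  have hf' (x : E) : fderiv ℝ (fun x : E => ⟪p, x⟫ ^ m) x p = m * ⟪p, x⟫ ^ (m - 1) := by
    rw [(hf x).fderiv]
    simp [hp]
  have hg' (x : E) : fderiv ℝ (fun x : E => Real.exp (-‖x‖ ^ 2)) x p =
      -2 * (⟪p, x⟫ * Real.exp (-‖x‖ ^ 2)) := by
    rw [(hg x).fderiv]
    simp [real_inner_comm]
    ring
  have key := integral_mul_fderiv_eq_neg_fderiv_mul_of_integrable (μ := volume)
    (f := fun x : E => ⟪p, x⟫ ^ m) (g := fun x : E => Real.exp (-‖x‖ ^ 2)) (v := p)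
    (by
      simp only [hf', mul_assoc]
      exact (integrable_inner_pow_mul_exp_neg_norm_sq p (m - 1)).const_mul _)
    (by
      simp only [hg']
      refine ((integrable_inner_pow_mul_exp_neg_norm_sq p (m + 1)).const_mul (-2)).congr
        (ae_of_all _ fun x => ?_)
      simp only
      ring)
    (integrable_inner_pow_mul_exp_neg_norm_sq p m)
    (fun x _ => (hf x).differentiableAt) (fun x _ => (hg x).differentiableAt)
  simp only [hf', hg', mul_assoc, integral_const_mul] at key
  have h2 (x : E) : ⟪p, x⟫ ^ m * (-2 * (⟪p, x⟫ * Real.exp (-‖x‖ ^ 2))) =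
      -2 * (⟪p, x⟫ ^ (m + 1) * Real.exp (-‖x‖ ^ 2)) := by ring
  simp only [h2, integral_const_mul] at key
  linarith

theorem integral_inner_pow_mul_exp_neg_norm_sq_eq_mul [Nontrivial E] (p : E) (m : ℕ) :
    ∫ x : E, ⟪p, x⟫ ^ m * Real.exp (-‖x‖ ^ 2) =
      (∫ q : Metric.sphere (0 : E) 1, ⟪p, (q : E)⟫ ^ m ∂(volume : Measure E).toSphere) *
        ∫ r in Set.Ioi (0 : ℝ), r ^ (Module.finrank ℝ E - 1 + m) * Real.exp (-r ^ 2) := by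
  set d := Module.finrank ℝ E - 1
  calc
    _ = ∫ x : ({(0)}ᶜ : Set E), ⟪p, (x : E)⟫ ^ m * Real.exp (-‖(x : E)‖ ^ 2)
          ∂((volume : Measure E).comap (↑)) := by
      rw [integral_subtype_comap (measurableSet_singleton _).compl
        fun x : E => ⟪p, x⟫ ^ m * Real.exp (-‖x‖ ^ 2), restrict_compl_singleton]
    _ = ∫ z : Metric.sphere (0 : E) 1 × Set.Ioi (0 : ℝ),
          ⟪p, (z.1 : E)⟫ ^ m * ((z.2 : ℝ) ^ m * Real.exp (-(z.2 : ℝ) ^ 2))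
          ∂(volume : Measure E).toSphere.prod (.volumeIoiPow d) := by
      rw [← (volume : Measure E).measurePreserving_homeomorphUnitSphereProd.integral_comp
        (Homeomorph.measurableEmbedding _)]
      congr 1
      ext x
      have hx : ‖(x : E)‖ ≠ 0 := norm_ne_zero_iff.2 x.2
      simp only [homeomorphUnitSphereProd_apply_fst_coe, homeomorphUnitSphereProd_apply_snd_coe,
        inner_smul_right, mul_pow, inv_pow]
      field_simp
    _ = (∫ q : Metric.sphere (0 : E) 1, ⟪p, (q : E)⟫ ^ m ∂(volume : Measure E).toSphere) *
          ∫ r : Set.Ioi (0 : ℝ), (r : ℝ) ^ m * Real.exp (-(r : ℝ) ^ 2) ∂.volumeIoiPow d :=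
      integral_prod_mul (fun q : Metric.sphere (0 : E) 1 => ⟪p, (q : E)⟫ ^ m)
        (fun r : Set.Ioi (0 : ℝ) => (r : ℝ) ^ m * Real.exp (-(r : ℝ) ^ 2))
    _ = _ := by
      congr 1
      simp only [Measure.volumeIoiPow, ENNReal.ofReal]
      rw [integral_withDensity_eq_integral_smul,
        integral_subtype_comap measurableSet_Ioi
          fun r : ℝ => Real.toNNReal (r ^ d) • (r ^ m * Real.exp (-r ^ 2)),
        setIntegral_congr_fun measurableSet_Ioi fun r hr => ?_]
      · rw [NNReal.smul_def, Real.coe_toNNReal _ (pow_nonneg (le_of_lt hr) _), smul_eq_mul,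
          pow_add, mul_assoc]
      · exact (measurable_subtype_coe.pow_const _).real_toNNReal

theorem integral_toSphere_inner_pow_recurrence (hE : 2 ≤ Module.finrank ℝ E) {p : E}
    (hp : ‖p‖ = 1) (m : ℕ) :
    ((Module.finrank ℝ E - 1 : ℕ) + m : ℝ) *
        ∫ q : Metric.sphere (0 : E) 1, ⟪p, (q : E)⟫ ^ (m + 1) ∂(volume : Measure E).toSphere =
      m * ∫ q : Metric.sphere (0 : E) 1, ⟪p, (q : E)⟫ ^ (m - 1)
        ∂(volume : Measure E).toSphere := by
  have : Nontrivial E := Module.nontrivial_of_finrank_pos (R := ℝ) (by omega)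
  have h := integral_inner_pow_mul_exp_neg_norm_sq_recurrence hp m
  rw [integral_inner_pow_mul_exp_neg_norm_sq_eq_mul,
    integral_inner_pow_mul_exp_neg_norm_sq_eq_mul] at h
  obtain ⟨d, hd⟩ : ∃ d, Module.finrank ℝ E - 1 = d + 1 := ⟨Module.finrank ℝ E - 2, by omega⟩
  rw [hd] at h ⊢
  have hR := integral_pow_add_two_mul_exp_neg_sq (d + m)
  have hR0 := (integral_pow_mul_exp_neg_sq_pos (d + m)).ne'
  rw [show d + 1 + (m + 1) = d + m + 2 by ring] at h
  push_cast at hR ⊢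
  rcases m with _ | m
  · have hR2 := (integral_pow_mul_exp_neg_sq_pos (d + 0 + 2)).ne'
    simp only [Nat.cast_zero, zero_mul, mul_eq_zero, hR2, or_false, OfNat.ofNat_ne_zero,
      false_or] at h
    rw [h]
    simp
  · rw [show d + 1 + (m + 1 - 1) = d + (m + 1) by omega] at h
    apply mul_right_cancel₀ hR0
    push_cast at h hR ⊢
    linear_combination h - (∫ q : Metric.sphere (0 : E) 1, ⟪p, (q : E)⟫ ^ (m + 1 + 1)
      ∂(volume : Measure E).toSphere) * hR

theorem integrable_toSphere_of_continuous {f : Metric.sphere (0 : E) 1 → ℝ} (hf : Continuous f) :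
    Integrable f (volume : Measure E).toSphere := by
  have : CompactSpace (Metric.sphere (0 : E) 1) :=
    isCompact_iff_compactSpace.1 (isCompact_sphere 0 1)
  exact hf.integrable_of_hasCompactSupport (HasCompactSupport.of_compactSpace f)

theorem integral_toSphere_polynomial_eq_zero (hE : 2 ≤ Module.finrank ℝ E) {p : E}
    (hp : ‖p‖ = 1) (f : Polynomial ℝ) :
    ∫ q : Metric.sphere (0 : E) 1, ((1 - ⟪p, (q : E)⟫ ^ 2) * f.derivative.eval ⟪p, (q : E)⟫ -
      (Module.finrank ℝ E - 1 : ℕ) * ⟪p, (q : E)⟫ * f.eval ⟪p, (q : E)⟫)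
        ∂(volume : Measure E).toSphere = 0 := by
  have hint (f : Polynomial ℝ) : Integrable (fun q : Metric.sphere (0 : E) 1 =>
      f.eval ⟪p, (q : E)⟫) (volume : Measure E).toSphere :=
    integrable_toSphere_of_continuous (f.continuous.comp (by fun_prop))
  set d := Module.finrank ℝ E - 1 with hd
  have hint' (f : Polynomial ℝ) : Integrable (fun q : Metric.sphere (0 : E) 1 =>
      (1 - ⟪p, (q : E)⟫ ^ 2) * f.derivative.eval ⟪p, (q : E)⟫ -
        d * ⟪p, (q : E)⟫ * f.eval ⟪p, (q : E)⟫) (volume : Measure E).toSphere := by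
    refine (hint ((1 - .X ^ 2) * f.derivative - .C (d : ℝ) * .X * f)).congr
      (ae_of_all _ fun q => ?_)
    simp only [Polynomial.eval_sub, Polynomial.eval_mul, Polynomial.eval_one, Polynomial.eval_pow,
      Polynomial.eval_X, Polynomial.eval_C]
  induction f using Polynomial.induction_on' with
  | add f g hf hg =>
    refine Eq.trans ?_ (((integral_add (hint' f) (hint' g)).trans (congrArg₂ _ hf hg)).trans
      (add_zero 0))
    congr 1
    ext q
    simp only [Polynomial.derivative_add, Polynomial.eval_add]
    ring
  | monomial m a =>
    have h := integral_toSphere_inner_pow_recurrence hE hp m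
    rw [← hd] at h
    have hi (k : ℕ) : Integrable (fun q : Metric.sphere (0 : E) 1 => ⟪p, (q : E)⟫ ^ k)
        (volume : Measure E).toSphere := by simpa using hint (.X ^ k)
    have e (q : Metric.sphere (0 : E) 1) :
        (1 - ⟪p, (q : E)⟫ ^ 2) * (Polynomial.monomial m a).derivative.eval ⟪p, (q : E)⟫ -
          d * ⟪p, (q : E)⟫ * (Polynomial.monomial m a).eval ⟪p, (q : E)⟫ =
        a * m * ⟪p, (q : E)⟫ ^ (m - 1) - a * (d + m) * ⟪p, (q : E)⟫ ^ (m + 1) := by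
      rcases m with _ | m
      · simp; ring
      · simp; ring
    simp only [e]
    rw [integral_sub ((hi _).const_mul _) ((hi _).const_mul _), integral_const_mul,
      integral_const_mul]
    linear_combination -a * h

theorem integral_toSphere_half_one_add_inner_pow_succ (hE : 2 ≤ Module.finrank ℝ E) {p : E}
    (hp : ‖p‖ = 1) (j : ℕ) :
    ((Module.finrank ℝ E - 1 : ℕ) + j : ℝ) *
        ∫ q : Metric.sphere (0 : E) 1, ((1 + ⟪p, (q : E)⟫) / 2) ^ (j + 1)
          ∂(volume : Measure E).toSphere =
      ((Module.finrank ℝ E - 1 : ℕ) / 2 + j : ℝ) *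
        ∫ q : Metric.sphere (0 : E) 1, ((1 + ⟪p, (q : E)⟫) / 2) ^ j
          ∂(volume : Measure E).toSphere := by
  have h := integral_toSphere_polynomial_eq_zero hE hp ((.C (1 / 2) * (1 + .X)) ^ j)
  set d := Module.finrank ℝ E - 1
  have hi (k : ℕ) : Integrable (fun q : Metric.sphere (0 : E) 1 => ((1 + ⟪p, (q : E)⟫) / 2) ^ k)
      (volume : Measure E).toSphere := integrable_toSphere_of_continuous (by fun_prop)
  have e (q : Metric.sphere (0 : E) 1) :
      (1 - ⟪p, (q : E)⟫ ^ 2) *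
          (Polynomial.derivative ((.C (1 / 2) * (1 + .X)) ^ j)).eval ⟪p, (q : E)⟫ -
        d * ⟪p, (q : E)⟫ * (((.C (1 / 2) * (1 + .X)) ^ j : Polynomial ℝ)).eval ⟪p, (q : E)⟫ =
      2 * (d / 2 + j) * ((1 + ⟪p, (q : E)⟫) / 2) ^ j -
        2 * (d + j) * ((1 + ⟪p, (q : E)⟫) / 2) ^ (j + 1) := by
    generalize ⟪p, (q : E)⟫ = s
    rcases j with _ | j
    · simp; ring
    · simp only [Polynomial.derivative_pow, Polynomial.derivative_mul, Polynomial.derivative_C,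
        Polynomial.derivative_add, Polynomial.derivative_one, Polynomial.derivative_X,
        Polynomial.eval_mul, Polynomial.eval_pow, Polynomial.eval_C, Polynomial.eval_add,
        Polynomial.eval_one, Polynomial.eval_X, Polynomial.eval_zero, Nat.add_sub_cancel]
      rw [show (1 + s) / 2 = 1 / 2 * (1 + s) by ring]
      push_cast
      ring
  simp only [e] at h
  rw [integral_sub ((hi _).const_mul _) ((hi _).const_mul _), integral_const_mul,
    integral_const_mul] at h
  linarith

end GaussianMoments

theorem incBeta_one_eq_beta {a b : ℝ} (ha : 0 < a) (hb : 0 < b) :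
    incBeta 1 a b = ProbabilityTheory.beta a b := by
  rw [ProbabilityTheory.beta_eq_betaIntegralReal a b ha hb, Complex.betaIntegral, incBeta,
    ← Complex.ofReal_re (∫ t in (0 : ℝ)..1, t ^ (a - 1) * (1 - t) ^ (b - 1)),
    ← intervalIntegral.integral_ofReal]
  congr 1
  refine intervalIntegral.integral_congr fun t ht => ?_
  rw [Set.uIcc_of_le zero_le_one] at ht
  simp only [Complex.ofReal_mul, Complex.ofReal_cpow ht.1,
    Complex.ofReal_cpow (sub_nonneg.2 ht.2), Complex.ofReal_sub, Complex.ofReal_one]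

theorem incBeta_one_pos {a b : ℝ} (ha : 0 < a) (hb : 0 < b) : 0 < incBeta 1 a b := by
  rw [incBeta_one_eq_beta ha hb]
  exact ProbabilityTheory.beta_pos ha hb

theorem incBeta_one_add_one {a b : ℝ} (ha : 0 < a) (hb : 0 < b) :
    (a + b) * incBeta 1 a (b + 1) = b * incBeta 1 a b := by
  have hab := (Real.Gamma_pos_of_pos (add_pos ha hb)).ne'
  have hab' : a + b ≠ 0 := (add_pos ha hb).ne'
  rw [incBeta_one_eq_beta ha hb, incBeta_one_eq_beta ha (by linarith), ProbabilityTheory.beta,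
    ProbabilityTheory.beta, ← add_assoc, Real.Gamma_add_one hb.ne', Real.Gamma_add_one hab']
  field_simp

theorem poch_pos {x : ℝ} (hx : 0 < x) (k : ℕ) : 0 < poch x k :=
  Finset.prod_pos fun i _ => by positivity

theorem poch_succ (x : ℝ) (k : ℕ) : poch x (k + 1) = poch x k * (x + k) :=
  Finset.prod_range_succ _ _

theorem poch_mul_incBeta {n : ℕ} (hn : 0 < n) (k : ℕ) :
    poch n k * (n + k) * incBeta 1 ((n : ℝ) / 2) ((n : ℝ) / 2 + k + 1) =
      n / 2 * poch ((n : ℝ) / 2 + 1) k * incBeta 1 ((n : ℝ) / 2) ((n : ℝ) / 2) := by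
  have hn' : (0 : ℝ) < n := by exact_mod_cast hn
  induction k with
  | zero =>
    have h := incBeta_one_add_one (half_pos hn') (half_pos hn')
    simp only [poch, Finset.range_zero, Finset.prod_empty, Nat.cast_zero, add_zero]
    linear_combination h
  | succ k ih =>
    have h := incBeta_one_add_one (a := (n : ℝ) / 2) (b := (n : ℝ) / 2 + k + 1)
      (by positivity) (by positivity)
    rw [poch_succ, poch_succ]
    push_cast
    rw [show (n : ℝ) / 2 + (k + 1) + 1 = n / 2 + k + 1 + 1 by ring]
    linear_combination (poch n k * (n + k)) * h + ((n : ℝ) / 2 + k + 1) * ih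

theorem integral_half_one_add_inner_pow {n : ℕ} (hn : 0 < n)
    (p : Metric.sphere (0 : EuclideanSpace ℝ (Fin (n + 1))) 1) (j : ℕ) :
    ∫ q, ((1 + ⟪(p : EuclideanSpace ℝ (Fin (n + 1))), q⟫) / 2) ^ j ∂(sphereMeasure n) =
      (sphereMeasure n).real Set.univ *
        (incBeta 1 ((n : ℝ) / 2) ((n : ℝ) / 2 + j) / incBeta 1 ((n : ℝ) / 2) ((n : ℝ) / 2)) := by
  have hn' : (0 : ℝ) < n := by exact_mod_cast hn
  have hB := (incBeta_one_pos (half_pos hn') (half_pos hn')).ne'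
  induction j with
  | zero => simp [hB]
  | succ j ih =>
    have hd : Module.finrank ℝ (EuclideanSpace ℝ (Fin (n + 1))) = n + 1 := by simp
    have h := integral_toSphere_half_one_add_inner_pow_succ
      (E := EuclideanSpace ℝ (Fin (n + 1))) (by omega) (norm_eq_of_mem_sphere p) j
    rw [hd, Nat.add_sub_cancel] at h
    have h' := incBeta_one_add_one (a := (n : ℝ) / 2) (b := (n : ℝ) / 2 + j)
      (by positivity) (by positivity)
    have h0 : (n + j : ℝ) ≠ 0 := by positivity
    apply mul_left_cancel₀ h0
    refine h.trans ?_
    rw [← sphereMeasure, ih]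
    push_cast
    rw [← add_assoc]
    generalize incBeta 1 ((n : ℝ) / 2) ((n : ℝ) / 2 + j) = u at h' ⊢
    generalize incBeta 1 ((n : ℝ) / 2) ((n : ℝ) / 2 + j + 1) = v at h' ⊢
    field_simp
    linear_combination -2 * (sphereMeasure n).real Set.univ * h'

theorem one_sub_norm_sub_sq_div_four {E : Type*} [NormedAddCommGroup E] [InnerProductSpace ℝ E]
    {p q : E} (hp : ‖p‖ = 1) (hq : ‖q‖ = 1) : 1 - ‖p - q‖ ^ 2 / 4 = (1 + ⟪p, q⟫) / 2 := by
  rw [norm_sub_sq_real, hp, hq]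
  ring

theorem half_one_add_inner_nonneg {E : Type*} [NormedAddCommGroup E] [InnerProductSpace ℝ E]
    {p q : E} (hp : ‖p‖ = 1) (hq : ‖q‖ = 1) : 0 ≤ (1 + ⟪p, q⟫) / 2 := by
  have := neg_le_of_abs_le (abs_real_inner_le_norm p q)
  rw [hp, hq] at this
  linarith

theorem stmt_9 (n : ℕ) (hn : 2 ≤ n)
    (p : Metric.sphere (0 : EuclideanSpace ℝ (Fin (n + 1))) 1) :
    ∫ q, green n ‖(p : EuclideanSpace ℝ (Fin (n + 1))) - (q : EuclideanSpace ℝ (Fin (n + 1)))‖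
        ∂(sphereMeasure n) = 0 := by
  have : IsFiniteMeasure (sphereMeasure n) := by unfold sphereMeasure; infer_instance
  have hn' : (0 : ℝ) < n := by exact_mod_cast (by omega : 0 < n)
  have hB := incBeta_one_pos (half_pos hn') (half_pos hn')
  have hp := norm_eq_of_mem_sphere p
  set c : ℕ → ℝ := fun k => poch n k / (((k : ℝ) + 1) * poch ((n : ℝ) / 2 + 1) k)
  set b : ℕ → ℝ := fun k =>
    incBeta 1 ((n : ℝ) / 2) ((n : ℝ) / 2 + k + 1) / incBeta 1 ((n : ℝ) / 2) ((n : ℝ) / 2)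
  set x : Metric.sphere (0 : EuclideanSpace ℝ (Fin (n + 1))) 1 → ℝ := fun q =>
    (1 + ⟪(p : EuclideanSpace ℝ (Fin (n + 1))), q⟫) / 2
  have hx0 (q) : 0 ≤ x q := half_one_add_inner_nonneg hp (norm_eq_of_mem_sphere q)
  have hc0 (k : ℕ) : 0 ≤ c k := by
    have := poch_pos hn' k
    have := poch_pos (by positivity : 0 < (n : ℝ) / 2 + 1) k
    positivity
  have hb0 (k : ℕ) : 0 ≤ b k :=
    (div_pos (incBeta_one_pos (by positivity) (by positivity)) hB).le
  have hcb (k : ℕ) : c k * b k ≤ n / 2 * (1 / ((k + 1 : ℕ) : ℝ) ^ 2) := by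
    have hP := poch_pos (by positivity : 0 < (n : ℝ) / 2 + 1) k
    have h : c k * b k = n / 2 * (1 / ((k + 1) * (n + k))) := by
      simp only [c, b]
      have := poch_mul_incBeta (by omega : 0 < n) k
      generalize incBeta 1 ((n : ℝ) / 2) ((n : ℝ) / 2 + k + 1) = u at this ⊢
      generalize poch ((n : ℝ) / 2 + 1) k = v at this hP ⊢
      field_simp
      linear_combination 2 * this
    rw [h]
    push_cast
    rw [sq]
    have : (1 : ℝ) ≤ n := by exact_mod_cast (by omega : 1 ≤ n)
    gcongr _ * (_ / (_ * ?_))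
    linarith
  have hint (k : ℕ) : Integrable (fun q => x q ^ (k + 1)) (sphereMeasure n) :=
    integrable_toSphere_of_continuous (by fun_prop)
  have hmean (k : ℕ) : ∫ q, x q ^ (k + 1) ∂(sphereMeasure n) =
      (sphereMeasure n).real Set.univ * b k := by
    have := integral_half_one_add_inner_pow (by omega : 0 < n) p (k + 1)
    push_cast at this
    rwa [← add_assoc] at this
  have hF (k : ℕ) : Integrable (fun q => c k * (x q ^ (k + 1) - b k)) (sphereMeasure n) :=
    ((hint k).sub (integrable_const _)).const_mul _
  have hsum : Summable fun k => ∫ q, ‖c k * (x q ^ (k + 1) - b k)‖ ∂(sphereMeasure n) := by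
    refine Summable.of_nonneg_of_le (fun k => integral_nonneg fun q => norm_nonneg _)
      (fun k => ?_) ((((summable_nat_add_iff 1).2
        (Real.summable_one_div_nat_pow.2 one_lt_two)).mul_left (n / 2 : ℝ)).mul_left
          (2 * (sphereMeasure n).real Set.univ))
    calc
      _ ≤ ∫ q, c k * (x q ^ (k + 1) + b k) ∂(sphereMeasure n) := by
        refine integral_mono (hF k).norm (((hint k).add (integrable_const _)).const_mul _)
          fun q => ?_
        simp only [norm_mul, Real.norm_of_nonneg (hc0 k)]
        refine mul_le_mul_of_nonneg_left ((norm_sub_le _ _).trans_eq ?_) (hc0 k)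
        rw [Real.norm_of_nonneg (pow_nonneg (hx0 q) _), Real.norm_of_nonneg (hb0 k)]
      _ = 2 * (sphereMeasure n).real Set.univ * (c k * b k) := by
        rw [integral_const_mul, integral_add (hint k) (integrable_const _), hmean, integral_const,
          smul_eq_mul]
        ring
      _ ≤ _ := mul_le_mul_of_nonneg_left (hcb k) (by positivity)
  have hterm (k : ℕ) : ∫ q, c k * (x q ^ (k + 1) - b k) ∂(sphereMeasure n) = 0 := by
    rw [integral_const_mul, integral_sub (hint k) (integrable_const _), hmean, integral_const,
      smul_eq_mul, sub_self, mul_zero]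
  have hgreen (q : Metric.sphere (0 : EuclideanSpace ℝ (Fin (n + 1))) 1) :
      green n ‖(p : EuclideanSpace ℝ (Fin (n + 1))) - q‖ =
        2 / (n * sphereVol n) * ∑' k : ℕ, c k * (x q ^ (k + 1) - b k) := by
    rw [green, one_sub_norm_sub_sq_div_four hp (norm_eq_of_mem_sphere q)]
  simp only [hgreen]
  rw [integral_const_mul, ← integral_tsum_of_summable_integral_norm hF hsum]
  simp only [hterm, tsum_zero, mul_zero]
end

section
/- Let n ≥ 3 be an integer. Then lim_{a → 0⁺} (K(n,π) − K(n,π−a))/a² = 1/((2n−4)·V_n); that is, K(n,π−a) = K(n,π) − a²/((2n−4)·V_n) + o(a²) as a → 0⁺. -/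
open MeasureTheory Real Filter
open scoped RealInnerProductSpace

theorem continuous_incBeta_integrand {p m : ℝ} (hp : 1 ≤ p) (hm : 1 ≤ m) :
    Continuous fun x : ℝ => x ^ (p - 1) * (1 - x) ^ (m - 1) :=
  (continuous_id.rpow_const fun _ => Or.inr (by linarith)).mul
    ((continuous_const.sub continuous_id).rpow_const fun _ => Or.inr (by linarith))

theorem hasDerivAt_incBeta {p m : ℝ} (hp : 1 ≤ p) (hm : 1 ≤ m) (t : ℝ) :
    HasDerivAt (fun s => incBeta s p m) (t ^ (p - 1) * (1 - t) ^ (m - 1)) t :=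
  intervalIntegral.integral_hasDerivAt_right
    ((continuous_incBeta_integrand hp hm).intervalIntegrable _ _)
    ((continuous_incBeta_integrand hp hm).stronglyMeasurableAtFilter _ _)
    (continuous_incBeta_integrand hp hm).continuousAt

theorem incBeta_pos {p m t : ℝ} (hp : 1 ≤ p) (hm : 1 ≤ m) (ht0 : 0 < t) (ht1 : t ≤ 1) :
    0 < incBeta t p m := by
  refine intervalIntegral.intervalIntegral_pos_of_pos_on
    ((continuous_incBeta_integrand hp hm).intervalIntegrable _ _) (fun x hx => ?_) ht0
  have h1 : 0 < 1 - x := by linarith [hx.2]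
  have h0 : 0 < x := hx.1
  positivity

/-- The contiguous relation obtained by integrating the derivative of `x ^ p * (1 - x) ^ m`. -/
theorem rpow_mul_rpow_eq_incBeta {p m t : ℝ} (hp : 1 ≤ p) (hm : 1 ≤ m) (ht0 : 0 ≤ t)
    (ht1 : t ≤ 1) :
    t ^ p * (1 - t) ^ m = p * incBeta t p m - (p + m) * incBeta t (p + 1) m := by
  have hder (x : ℝ) : HasDerivAt (fun x : ℝ => x ^ p * (1 - x) ^ m)
      (p * x ^ (p - 1) * (1 - x) ^ m + x ^ p * (-1 * m * (1 - x) ^ (m - 1))) x :=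
    (Real.hasDerivAt_rpow_const (Or.inr hp)).mul
      (((hasDerivAt_id x).const_sub 1).rpow_const (Or.inr hm))
  have hcont : Continuous fun x : ℝ =>
      p * x ^ (p - 1) * (1 - x) ^ m + x ^ p * (-1 * m * (1 - x) ^ (m - 1)) := by
    fun_prop (disch := intros; first | positivity | (right; linarith))
  have hftc := intervalIntegral.integral_eq_sub_of_hasDerivAt (a := 0) (b := t)
    (fun x _ => hder x) (hcont.intervalIntegrable _ _)
  rw [Real.zero_rpow (by linarith), zero_mul, sub_zero] at hftc
  rw [← hftc, incBeta, incBeta, ← intervalIntegral.integral_const_mul,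
    ← intervalIntegral.integral_const_mul, ← intervalIntegral.integral_sub
      (((continuous_incBeta_integrand hp hm).intervalIntegrable _ _).const_mul _)
      (((continuous_incBeta_integrand (by linarith) hm).intervalIntegrable _ _).const_mul _)]
  refine intervalIntegral.integral_congr fun x hx => ?_
  rw [Set.uIcc_of_le ht0] at hx
  have hxp : x ^ p = x ^ (p - 1) * x := by
    conv_lhs => rw [← sub_add_cancel p 1,
      Real.rpow_add_one' hx.1 (by linarith)]
  have hxm : (1 - x) ^ m = (1 - x) ^ (m - 1) * (1 - x) := by
    conv_lhs => rw [← sub_add_cancel m 1,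
      Real.rpow_add_one' (by linarith [hx.2]) (by linarith)]
  simp only [add_sub_cancel_right, hxm, hxp]
  ring

theorem incBeta_add_nat_le {m t : ℝ} (hm : 1 ≤ m) (ht0 : 0 ≤ t) (ht1 : t ≤ 1) (k : ℕ) :
    incBeta t (m + k) m ≤ t ^ k * incBeta t m m := by
  have hmk : 1 ≤ m + k := by linarith [k.cast_nonneg (α := ℝ)]
  rw [incBeta, incBeta, ← intervalIntegral.integral_const_mul]
  refine intervalIntegral.integral_mono_on ht0
    ((continuous_incBeta_integrand hmk hm).intervalIntegrable _ _)
    (((continuous_incBeta_integrand hm hm).intervalIntegrable _ _).const_mul _) fun x hx => ?_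
  have h1 : 0 ≤ 1 - x := by linarith [hx.2]
  have h2 : x ^ (m + k - 1) = x ^ k * x ^ (m - 1) := by
    rcases hm.eq_or_lt with rfl | hm
    · simp [add_sub_cancel_left]
    · rw [show m + k - 1 = (m - 1) + k by ring, Real.rpow_add_natCast' hx.1 (by positivity),
        mul_comm]
  rw [h2, mul_assoc]
  gcongr
  · have := hx.1; positivity
  · exact hx.1
  · exact hx.2

/-- The Taylor coefficients of `₂F₁(2 m, 1; m + 1; t)`. -/
noncomputable def hyperCoeff (m : ℝ) (k : ℕ) : ℝ := poch (2 * m) k / poch (m + 1) k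

theorem hyperCoeff_pos {m : ℝ} (hm : 1 ≤ m) (k : ℕ) : 0 < hyperCoeff m k :=
  div_pos (poch_pos (by linarith) k) (poch_pos (by linarith) k)

theorem hyperCoeff_succ {m : ℝ} (hm : 1 ≤ m) (k : ℕ) :
    (m + 1 + k) * hyperCoeff m (k + 1) = (2 * m + k) * hyperCoeff m k := by
  have h1 : m + 1 + k ≠ 0 := by positivity
  have h2 := (poch_pos (show 0 < m + 1 by linarith) k).ne'
  rw [hyperCoeff, hyperCoeff, poch_succ, poch_succ]
  field_simp

theorem sum_range_hyperCoeff {m t : ℝ} (hm : 1 ≤ m) (ht0 : 0 < t) (ht1 : t ≤ 1) (K : ℕ) :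
    t ^ m * (1 - t) ^ m * ∑ k ∈ Finset.range K, hyperCoeff m k * t ^ k =
      m * incBeta t m m - (m + K) * hyperCoeff m K * incBeta t (m + K) m := by
  induction K with
  | zero => simp [hyperCoeff, poch]
  | succ K ih =>
    have hrec := rpow_mul_rpow_eq_incBeta (p := m + K)
      (by linarith [K.cast_nonneg (α := ℝ)]) hm ht0.le ht1
    rw [Real.rpow_add_natCast ht0.ne'] at hrec
    rw [Finset.sum_range_succ, mul_add, ih]
    push_cast
    rw [← add_assoc]
    linear_combination hyperCoeff m K * hrec +
      incBeta t (m + K + 1) m * hyperCoeff_succ hm K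

theorem sum_range_hyperCoeff_le {m t : ℝ} (hm : 1 ≤ m) (ht0 : 0 < t) (ht1 : t < 1) (K : ℕ) :
    ∑ k ∈ Finset.range K, hyperCoeff m k * t ^ k ≤
      m * incBeta t m m / (t ^ m * (1 - t) ^ m) := by
  have h1 : 0 < 1 - t := by linarith
  have hw : 0 < t ^ m * (1 - t) ^ m := by positivity
  have hr := incBeta_pos (p := m + K) (by linarith [K.cast_nonneg (α := ℝ)]) hm ht0 ht1.le
  have hg := hyperCoeff_pos hm K
  rw [le_div_iff₀ hw, mul_comm, sum_range_hyperCoeff hm ht0 ht1.le]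
  have : 0 ≤ (m + K) * hyperCoeff m K * incBeta t (m + K) m := by positivity
  linarith

theorem summable_hyperCoeff_mul_pow {m t : ℝ} (hm : 1 ≤ m) (ht0 : 0 < t) (ht1 : t < 1) :
    Summable fun k => hyperCoeff m k * t ^ k :=
  summable_of_sum_range_le (fun k => by have := hyperCoeff_pos hm k; positivity)
    (sum_range_hyperCoeff_le hm ht0 ht1)

theorem tendsto_mul_hyperCoeff_mul_pow {m t : ℝ} (hm : 1 ≤ m) (ht0 : 0 < t) (ht1 : t < 1) :
    Tendsto (fun K : ℕ => (m + K) * (hyperCoeff m K * t ^ K)) atTop (nhds 0) := by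
  obtain ⟨r, htr, hr1⟩ := exists_between ht1
  have hr0 : 0 < r := ht0.trans htr
  have hq0 : 0 ≤ t / r := by positivity
  have hq1 : t / r < 1 := (div_lt_one hr0).2 htr
  have hgeom := ((tendsto_pow_atTop_nhds_zero_of_lt_one hq0 hq1).const_mul m).add
    (tendsto_self_mul_const_pow_of_lt_one hq0 hq1)
  have := hgeom.mul (summable_hyperCoeff_mul_pow hm hr0 hr1).tendsto_atTop_zero
  rw [mul_zero] at this
  refine this.congr fun K => ?_
  rw [div_pow]
  field_simp

theorem tsum_hyperCoeff_mul_pow {m t : ℝ} (hm : 1 ≤ m) (ht0 : 0 < t) (ht1 : t < 1) :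
    ∑' k, hyperCoeff m k * t ^ k = m * incBeta t m m / (t ^ m * (1 - t) ^ m) := by
  have h1 : 0 < 1 - t := by linarith
  have hw : 0 < t ^ m * (1 - t) ^ m := by positivity
  rw [eq_div_iff hw.ne', mul_comm]
  have hrem : Tendsto (fun K : ℕ => (m + K) * hyperCoeff m K * incBeta t (m + K) m)
      atTop (nhds 0) := by
    have hlim := (tendsto_mul_hyperCoeff_mul_pow hm ht0 ht1).mul_const (incBeta t m m)
    rw [zero_mul] at hlim
    refine squeeze_zero (fun K => ?_) (fun K => ?_) hlim
    · have := hyperCoeff_pos hm K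
      have := incBeta_pos (p := m + K) (by linarith [K.cast_nonneg (α := ℝ)]) hm ht0 ht1.le
      positivity
    · have hg := hyperCoeff_pos hm K
      have hle := incBeta_add_nat_le hm ht0.le ht1.le K
      calc _ ≤ (m + K) * hyperCoeff m K * (t ^ K * incBeta t m m) := by gcongr
        _ = _ := by ring
  have hlim := ((summable_hyperCoeff_mul_pow hm ht0 ht1).hasSum.tendsto_sum_nat).const_mul
    (t ^ m * (1 - t) ^ m)
  simp_rw [sum_range_hyperCoeff hm ht0 ht1.le] at hlim
  refine tendsto_nhds_unique hlim ?_
  simpa using hrem.const_sub (m * incBeta t m m)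

theorem eventually_div_lt_of_hasDerivAt {f f' g g' : ℝ → ℝ} {b l c : ℝ}
    (hf : ∀ᶠ x in nhdsWithin b (Set.Iio b), HasDerivAt f (f' x) x)
    (hg : ∀ᶠ x in nhdsWithin b (Set.Iio b), HasDerivAt g (g' x) x)
    (hg' : ∀ᶠ x in nhdsWithin b (Set.Iio b), 0 < g' x)
    (hgtop : Tendsto g (nhdsWithin b (Set.Iio b)) atTop)
    (hlim : Tendsto (fun x => f' x / g' x) (nhdsWithin b (Set.Iio b)) (nhds l)) (hlc : l < c) :
    ∀ᶠ x in nhdsWithin b (Set.Iio b), f x / g x < c := by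
  obtain ⟨d, hld, hdc⟩ := exists_between hlc
  have hev := (hf.and (hg.and (hg'.and (hlim.eventually_lt_const hld))))
  obtain ⟨x₀, hx₀, hx₀'⟩ := (mem_nhdsLT_iff_exists_Ioo_subset).1 hev
  obtain ⟨x₁, hx₁, hx₁b⟩ := exists_between (show x₀ < b from hx₀)
  have hsub {x : ℝ} (hx : x ∈ Set.Ico x₁ b) := hx₀' (show x ∈ Set.Ioo x₀ b from
    ⟨hx₁.trans_le hx.1, hx.2⟩)
  have hder {x : ℝ} (hx : x ∈ Set.Ico x₁ b) :
      HasDerivAt (fun x => f x - d * g x) (f' x - d * g' x) x :=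
    (hsub hx).1.sub ((hsub hx).2.1.const_mul d)
  have hanti : AntitoneOn (fun x => f x - d * g x) (Set.Ico x₁ b) := by
    refine antitoneOn_of_deriv_nonpos (convex_Ico _ _)
      (fun x hx => (hder hx).continuousAt.continuousWithinAt)
      (fun x hx => (hder (interior_subset hx)).differentiableAt.differentiableWithinAt)
      fun x hx => ?_
    obtain ⟨-, -, hpos, hlt⟩ := hsub (interior_subset hx)
    rw [(hder (interior_subset hx)).deriv]
    linarith [(div_lt_iff₀ hpos).1 hlt]
  filter_upwards [Ioo_mem_nhdsLT hx₁b, hgtop.eventually_gt_atTop 0,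
    hgtop.eventually_gt_atTop ((f x₁ - d * g x₁) / (c - d))] with x hx hpos hbig
  have h1 : f x - d * g x ≤ f x₁ - d * g x₁ :=
    hanti ⟨le_rfl, hx₁b⟩ ⟨hx.1.le, hx.2⟩ hx.1.le
  rw [div_lt_iff₀ hpos]
  rw [div_lt_iff₀ (by linarith)] at hbig
  linarith

/-- L'Hôpital's rule at a left endpoint when the denominator tends to infinity. -/
theorem tendsto_div_of_hasDerivAt_of_tendsto_atTop {f f' g g' : ℝ → ℝ} {b l : ℝ}
    (hf : ∀ᶠ x in nhdsWithin b (Set.Iio b), HasDerivAt f (f' x) x)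
    (hg : ∀ᶠ x in nhdsWithin b (Set.Iio b), HasDerivAt g (g' x) x)
    (hg' : ∀ᶠ x in nhdsWithin b (Set.Iio b), 0 < g' x)
    (hgtop : Tendsto g (nhdsWithin b (Set.Iio b)) atTop)
    (hlim : Tendsto (fun x => f' x / g' x) (nhdsWithin b (Set.Iio b)) (nhds l)) :
    Tendsto (fun x => f x / g x) (nhdsWithin b (Set.Iio b)) (nhds l) := by
  refine tendsto_order.2 ⟨fun c hc => ?_, fun c hc =>
    eventually_div_lt_of_hasDerivAt hf hg hg' hgtop hlim hc⟩
  have := eventually_div_lt_of_hasDerivAt (f := fun x => -f x) (f' := fun x => -f' x) (l := -l)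
    (c := -c) (hf.mono fun x hx => hx.neg) hg hg' hgtop
    (by simpa only [neg_div] using hlim.neg) (neg_lt_neg hc)
  filter_upwards [this] with x hx
  rw [neg_div] at hx
  linarith

/-- The primitive of `₂F₁(2 m, 1; m + 1; t)` vanishing at `0`. -/
noncomputable def hyperPrimitive (m t : ℝ) : ℝ :=
  ∑' k : ℕ, hyperCoeff m k / (k + 1) * t ^ (k + 1)

theorem summable_hyperPrimitive {m t : ℝ} (hm : 1 ≤ m) (ht0 : 0 < t) (ht1 : t < 1) :
    Summable fun k : ℕ => hyperCoeff m k / (k + 1) * t ^ (k + 1) := by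
  refine Summable.of_nonneg_of_le (fun k => ?_) (fun k => ?_)
    (summable_hyperCoeff_mul_pow hm ht0 ht1)
  · have := hyperCoeff_pos hm k
    positivity
  · have hg := hyperCoeff_pos hm k
    have h1 : hyperCoeff m k / (k + 1) ≤ hyperCoeff m k :=
      div_le_self hg.le (by linarith [k.cast_nonneg (α := ℝ)])
    have h2 : t ^ (k + 1) ≤ t ^ k := pow_le_pow_of_le_one ht0.le ht1.le k.le_succ
    gcongr

theorem hasDerivAt_hyperPrimitive {m t : ℝ} (hm : 1 ≤ m) (ht : |t| < 1) :
    HasDerivAt (hyperPrimitive m) (∑' k, hyperCoeff m k * t ^ k) t := by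
  obtain ⟨r, htr, hr1⟩ := exists_between ht
  have hr0 : 0 < r := (abs_nonneg t).trans_lt htr
  refine hasDerivAt_tsum_of_isPreconnected (t := Set.Ioo (-r) r) (y₀ := 0)
    (summable_hyperCoeff_mul_pow hm hr0 hr1) isOpen_Ioo isPreconnected_Ioo
    (g := fun k x => hyperCoeff m k / (k + 1) * x ^ (k + 1))
    (g' := fun k x => hyperCoeff m k * x ^ k) (fun k x _ => ?_) (fun k x hx => ?_)
    ⟨by linarith, hr0⟩ (by simp) (abs_lt.1 htr)
  · refine ((hasDerivAt_pow (k + 1) x).const_mul _).congr_deriv ?_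
    have : (k : ℝ) + 1 ≠ 0 := by positivity
    push_cast
    field_simp
  · rw [norm_mul, norm_pow, Real.norm_of_nonneg (hyperCoeff_pos hm k).le]
    have := hyperCoeff_pos hm k
    gcongr
    exact (abs_lt.2 hx).le

theorem tendsto_hyperPrimitive_mul_rpow {m : ℝ} (hm : 1 < m) :
    Tendsto (fun t => hyperPrimitive m t * (1 - t) ^ (m - 1)) (nhdsWithin 1 (Set.Iio 1))
      (nhds (m * incBeta 1 m m / (m - 1))) := by
  have hmem : Set.Ioo (0 : ℝ) 1 ∈ nhdsWithin 1 (Set.Iio 1) := Ioo_mem_nhdsLT one_pos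
  have hsub : Tendsto (fun t : ℝ => 1 - t) (nhdsWithin 1 (Set.Iio 1))
      (nhdsWithin 0 (Set.Ioi 0)) := by
    refine tendsto_nhdsWithin_iff.2 ⟨?_, ?_⟩
    · have : Tendsto (fun t : ℝ => 1 - t) (nhds 1) (nhds (1 - 1)) :=
        tendsto_const_nhds.sub tendsto_id
      rw [sub_self] at this
      exact this.mono_left nhdsWithin_le_nhds
    · filter_upwards [hmem] with t ht
      exact sub_pos.2 ht.2
  have key := tendsto_div_of_hasDerivAt_of_tendsto_atTop (b := 1)
    (f := hyperPrimitive m) (f' := fun t => ∑' k, hyperCoeff m k * t ^ k)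
    (g := fun t => (1 - t) ^ (1 - m)) (g' := fun t => (m - 1) * (1 - t) ^ (-m))
    (l := m * incBeta 1 m m / (m - 1)) ?_ ?_ ?_ ?_ ?_
  · refine key.congr' ?_
    filter_upwards [hmem] with t ht
    rw [div_eq_mul_inv, ← Real.rpow_neg (sub_pos.2 ht.2).le, neg_sub]
  · filter_upwards [hmem] with t ht
    exact hasDerivAt_hyperPrimitive hm.le (abs_lt.2 ⟨by linarith [ht.1], ht.2⟩)
  · filter_upwards [hmem] with t ht
    refine (((hasDerivAt_id t).const_sub 1).rpow_const
      (Or.inl (sub_pos.2 ht.2).ne')).congr_deriv ?_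
    rw [show 1 - m - 1 = -m by ring]
    simp only [id]
    ring
  · filter_upwards [hmem] with t ht
    exact mul_pos (sub_pos.2 hm) (Real.rpow_pos_of_pos (sub_pos.2 ht.2) _)
  · exact (tendsto_rpow_neg_nhdsGT_zero (by linarith)).comp hsub
  · have hlim : Tendsto (fun t => m * incBeta t m m / ((m - 1) * t ^ m)) (nhds 1)
        (nhds (m * incBeta 1 m m / ((m - 1) * 1 ^ m))) := by
      refine ((hasDerivAt_incBeta hm.le hm.le 1).continuousAt.tendsto.const_mul m).div
        ((Real.continuousAt_rpow_const 1 m (Or.inl one_ne_zero)).tendsto.const_mul _) ?_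
      rw [Real.one_rpow, mul_one]
      exact (sub_pos.2 hm).ne'
    rw [Real.one_rpow, mul_one] at hlim
    refine (hlim.mono_left nhdsWithin_le_nhds).congr' ?_
    filter_upwards [hmem] with t ht
    have h1 : 0 < 1 - t := sub_pos.2 ht.2
    have h2 := Real.rpow_pos_of_pos ht.1 m
    have h3 := Real.rpow_pos_of_pos h1 m
    have h4 : m - 1 ≠ 0 := (sub_pos.2 hm).ne'
    rw [tsum_hyperCoeff_mul_pow hm.le ht.1 ht.2, Real.rpow_neg h1.le]
    field_simp

/-- The integrand `hyperPrimitive m t * t ^ (m - 1) * (1 - t) ^ (m - 1)`, extended by continuity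
to `t = 1`. -/
noncomputable def hyperIntegrand (m : ℝ) : ℝ → ℝ :=
  Function.update (fun t => hyperPrimitive m t * (1 - t) ^ (m - 1) * t ^ (m - 1)) 1
    (m * incBeta 1 m m / (m - 1))

theorem continuousOn_hyperIntegrand {m : ℝ} (hm : 1 < m) :
    ContinuousOn (hyperIntegrand m) (Set.Icc 0 1) := by
  have hpow (t : ℝ) : ContinuousAt (fun t : ℝ => t ^ (m - 1)) t :=
    Real.continuousAt_rpow_const t _ (Or.inr (by linarith))
  refine continuousOn_update_iff.2 ⟨fun t ht => ?_, fun _ => ?_⟩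
  · have ht1 : t < 1 := lt_of_le_of_ne ht.1.2 ht.2
    refine ContinuousAt.continuousWithinAt ?_
    exact ((hasDerivAt_hyperPrimitive hm.le
      (abs_lt.2 ⟨by linarith [ht.1.1], ht1⟩)).continuousAt.mul
      ((continuousAt_const.sub continuousAt_id).rpow_const (Or.inr (by linarith)))).mul (hpow t)
  · have := (tendsto_hyperPrimitive_mul_rpow hm).mul
      ((hpow 1).tendsto.mono_left nhdsWithin_le_nhds)
    rw [Real.one_rpow, mul_one] at this
    exact this.mono_left (nhdsWithin_mono _ fun t ht => lt_of_le_of_ne ht.1.2 ht.2)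

theorem hasSum_hyperIntegrand {m t : ℝ} (hm : 1 < m) (ht0 : 0 < t) (ht1 : t < 1) :
    HasSum (fun k : ℕ => hyperCoeff m k / (k + 1) * (t ^ (m + k + 1 - 1) * (1 - t) ^ (m - 1)))
      (hyperIntegrand m t) := by
  rw [hyperIntegrand, Function.update_of_ne ht1.ne]
  convert! ((summable_hyperPrimitive hm.le ht0 ht1).hasSum.mul_right
    ((1 - t) ^ (m - 1) * t ^ (m - 1))) using 1
  · ext k
    rw [show m + k + 1 - 1 = (m - 1) + (k + 1 : ℕ) by push_cast; ring,
      Real.rpow_add_natCast ht0.ne']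
    ring
  · rw [hyperPrimitive, mul_assoc]

theorem hasSum_incBeta {m s : ℝ} (hm : 1 < m) (hs0 : 0 ≤ s) (hs1 : s ≤ 1) :
    HasSum (fun k : ℕ => hyperCoeff m k / (k + 1) * incBeta s (m + k + 1) m)
      (∫ t in (0 : ℝ)..s, hyperIntegrand m t) := by
  have hcont (k : ℕ) := continuous_incBeta_integrand (p := m + k + 1) (m := m)
    (by linarith [k.cast_nonneg (α := ℝ)]) hm.le
  have hae : ∀ᵐ t : ℝ, t ∈ Set.uIoc 0 s → 0 < t ∧ t < 1 := by
    filter_upwards [Measure.ae_ne volume (1 : ℝ)] with t ht hts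
    rw [Set.uIoc_of_le hs0] at hts
    exact ⟨hts.1, lt_of_le_of_ne (hts.2.trans hs1) ht⟩
  have hint : IntervalIntegrable (hyperIntegrand m) volume 0 s :=
    ((continuousOn_hyperIntegrand hm).mono
      (by rw [Set.uIcc_of_le hs0]; exact Set.Icc_subset_Icc_right hs1)).intervalIntegrable
  simp only [incBeta, ← intervalIntegral.integral_const_mul]
  refine intervalIntegral.hasSum_integral_of_dominated_convergence
    (fun (k : ℕ) t => hyperCoeff m k / (k + 1) * (t ^ (m + k + 1 - 1) * (1 - t) ^ (m - 1)))
    (fun k => ((hcont k).const_mul _).aestronglyMeasurable) (fun k => ?_) ?_ ?_ ?_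
  · filter_upwards [hae] with t ht hts
    obtain ⟨h0, h1⟩ := ht hts
    have h1' := sub_pos.2 h1
    have := hyperCoeff_pos hm.le k
    exact (Real.norm_of_nonneg (by positivity)).le
  · filter_upwards [hae] with t ht hts
    exact (hasSum_hyperIntegrand hm (ht hts).1 (ht hts).2).summable
  · refine hint.congr_ae ((ae_restrict_iff' measurableSet_uIoc).2 ?_)
    filter_upwards [hae] with t ht hts
    exact (hasSum_hyperIntegrand hm (ht hts).1 (ht hts).2).tsum_eq.symm
  · filter_upwards [hae] with t ht hts
    exact hasSum_hyperIntegrand hm (ht hts).1 (ht hts).2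

theorem hasDerivWithinAt_integral_hyperIntegrand {m : ℝ} (hm : 1 < m) :
    HasDerivWithinAt (fun s => ∫ t in (0 : ℝ)..s, hyperIntegrand m t)
      (m * incBeta 1 m m / (m - 1)) (Set.Iic 1) 1 := by
  have hcont := continuousOn_hyperIntegrand hm
  have hval : hyperIntegrand m 1 = m * incBeta 1 m m / (m - 1) := Function.update_self ..
  have hmem : Set.Icc (0 : ℝ) 1 ∈ nhdsWithin 1 (Set.Iic 1) := Icc_mem_nhdsLE one_pos
  rw [← hval]
  refine intervalIntegral.integral_hasDerivWithinAt_right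
    (ContinuousOn.intervalIntegrable (by rwa [Set.uIcc_of_le zero_le_one])) (t := Set.Iic 1)
    ⟨_, hmem, hcont.aestronglyMeasurable measurableSet_Icc⟩ ?_
  exact (hcont 1 ⟨zero_le_one, le_rfl⟩).mono_of_mem_nhdsWithin hmem

theorem hasDerivWithinAt_integral_div_incBeta {m : ℝ} (hm : 1 < m) :
    HasDerivWithinAt (fun s => (∫ t in (0 : ℝ)..s, hyperIntegrand m t) / incBeta s m m)
      (m / (m - 1)) (Set.Iic 1) 1 := by
  have hI := (incBeta_pos hm.le hm.le one_pos le_rfl).ne'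
  have hm1 := (sub_pos.2 hm).ne'
  refine ((hasDerivWithinAt_integral_hyperIntegrand hm).div
    (hasDerivAt_incBeta hm.le hm.le 1).hasDerivWithinAt hI).congr_deriv ?_
  rw [sub_self, Real.zero_rpow hm1]
  field_simp
  ring

theorem Kfun_eq {n : ℕ} (hn : 3 ≤ n) (a : ℝ) :
    Kfun n a = 2 / (n * sphereVol n) *
      ((∫ t in (0 : ℝ)..Real.sin (a / 2) ^ 2, hyperIntegrand ((n : ℝ) / 2) t) /
        incBeta (Real.sin (a / 2) ^ 2) ((n : ℝ) / 2) ((n : ℝ) / 2)) := by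
  have hm : 1 < (n : ℝ) / 2 := by
    have : (3 : ℝ) ≤ n := by exact_mod_cast hn
    linarith
  rw [Kfun, ← ((hasSum_incBeta hm (sq_nonneg _) (Real.sin_sq_le_one (a / 2))).div_const
    (incBeta (Real.sin (a / 2) ^ 2) ((n : ℝ) / 2) ((n : ℝ) / 2))).tsum_eq]
  congr 2
  ext k
  rw [hyperCoeff, mul_div_cancel₀ _ two_ne_zero, div_div, mul_div_assoc]

theorem tendsto_sin_half_sq_div_sq :
    Tendsto (fun a : ℝ => Real.sin (a / 2) ^ 2 / a ^ 2) (nhdsWithin 0 (Set.Ioi 0))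
      (nhds (1 / 4)) := by
  have hder : HasDerivAt (fun a : ℝ => Real.sin (a / 2)) (1 / 2) 0 := by
    simpa using ((hasDerivAt_id (0 : ℝ)).div_const 2).sin
  have h := (hasDerivWithinAt_iff_tendsto_slope' (Set.self_notMem_Ioi (a := (0 : ℝ)))).1
    hder.hasDerivWithinAt
  have h2 := h.pow 2
  norm_num at h2
  refine h2.congr fun a => ?_
  simp [slope_def_field, div_pow]

theorem stmt_12 (n : ℕ) (hn : 3 ≤ n) :
    Tendsto (fun a : ℝ => (Kfun n π - Kfun n (π - a)) / a ^ 2) (nhdsWithin 0 (Set.Ioi 0))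
      (nhds (1 / ((2 * (n : ℝ) - 4) * sphereVol n))) := by
  have hn' : (3 : ℝ) ≤ n := by exact_mod_cast hn
  have hm : 1 < (n : ℝ) / 2 := by linarith
  have hV : sphereVol n ≠ 0 := by
    have := Real.Gamma_pos_of_pos (show 0 < ((n : ℝ) + 1) / 2 by positivity)
    rw [sphereVol]
    positivity
  have hmaps : Tendsto (fun a : ℝ => Real.sin ((π - a) / 2) ^ 2) (nhdsWithin 0 (Set.Ioi 0))
      (nhdsWithin 1 (Set.Iic 1 \ {1})) := by
    refine tendsto_nhdsWithin_iff.2 ⟨?_, ?_⟩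
    · have : Continuous fun a : ℝ => Real.sin ((π - a) / 2) ^ 2 := by fun_prop
      have := this.tendsto 0
      simp only [sub_zero, Real.sin_pi_div_two, one_pow] at this
      exact this.mono_left nhdsWithin_le_nhds
    · filter_upwards [Ioo_mem_nhdsGT Real.pi_pos] with a ha
      refine ⟨Real.sin_sq_le_one _, fun h => ?_⟩
      have hpos := Real.sin_pos_of_pos_of_lt_pi (x := a / 2) (by linarith [ha.1])
        (by linarith [ha.2, Real.pi_pos])
      rw [Set.mem_singleton_iff, sub_div, Real.sin_pi_div_two_sub, Real.cos_sq'] at h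
      nlinarith
  have hslope := (hasDerivWithinAt_iff_tendsto_slope.1
    (hasDerivWithinAt_integral_div_incBeta hm)).comp hmaps
  have hmain := (hslope.mul tendsto_sin_half_sq_div_sq).const_mul (2 / (n * sphereVol n))
  have hval : 2 / (n * sphereVol n) * ((n : ℝ) / 2 / ((n : ℝ) / 2 - 1) * (1 / 4)) =
      1 / ((2 * (n : ℝ) - 4) * sphereVol n) := by
    have h1 : (n : ℝ) - 2 ≠ 0 := by linarith
    have h2 : (n : ℝ) / 2 - 1 = (n - 2) / 2 := by ring
    have h3 : 2 * (n : ℝ) - 4 = 2 * (n - 2) := by ring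
    rw [h2, h3]
    field_simp
    norm_num
  rw [hval] at hmain
  refine hmain.congr' ?_
  filter_upwards [Ioo_mem_nhdsGT Real.pi_pos] with a ha
  have hpos := Real.sin_pos_of_pos_of_lt_pi (x := a / 2) (by linarith [ha.1])
    (by linarith [ha.2, Real.pi_pos])
  have hsin : Real.sin ((π - a) / 2) ^ 2 - 1 = -Real.sin (a / 2) ^ 2 := by
    rw [sub_div, Real.sin_pi_div_two_sub, Real.cos_sq']
    ring
  have ha0 := ha.1
  rw [Kfun_eq hn, Kfun_eq hn, Real.sin_pi_div_two, one_pow, Function.comp_apply,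
    slope_def_field, hsin]
  field_simp
  ring
end
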